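/- arXiv:1806.10379 — 6 statements merged into one kernel-verified Lean document; each statement's English description precedes it below -/
import Mathlib

section
/- Let n ≥ 2, let σ = ±1, and let q_1,…,q_n be a circular solution of the curved n-body system on M_σ² in which all masses are equal, m_1 = … = m_n = m > 0. Assume either σ = −1, or σ = 1 and r(t) < √10/5 for all t. If the minimal angular gap function μ₁ has a local minimum at some time t₀, then the solution is a polygonal rotopulsator with regular polygon configuration: there exists a twice continuously differentiable function φ : ℝ → ℝ such that θ_i(t) = φ(t) + 2π(i−1)/n for all i ∈ {1,…,n} and all t. -/
open Real

/-- The bilinear form `x ⊙ y = x₁y₁ + x₂y₂ + σx₃y₃` on `ℝ³ = ℝ × ℝ × ℝ`. -/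
def odot (σ : ℝ) (x y : ℝ × ℝ × ℝ) : ℝ :=
  x.1 * y.1 + x.2.1 * y.2.1 + σ * x.2.2 * y.2.2

/-- The squared-distance kernel `σ - σ (q ⊙ q')²` of two bodies on the circle of radius `R` in
`M_σ²` whose angular coordinates differ by `α`. -/
noncomputable def circleKernel (σ R α : ℝ) : ℝ :=
  R ^ 2 * (1 - cos α) * (2 - σ * R ^ 2 * (1 - cos α))

/-- The tangential force, up to a factor, between two bodies on the circle of radius `R` in
`M_σ²` whose angular coordinates differ by `α`. -/
noncomputable def tangentialForce (σ R α : ℝ) : ℝ :=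
  sin α * circleKernel σ R α ^ (-(3 / 2 : ℝ))

/-- The derivative of `tangentialForce σ R`. -/
noncomputable def tangentialForceDeriv (σ R α : ℝ) : ℝ :=
  cos α * circleKernel σ R α ^ (-(3 / 2 : ℝ)) +
    sin α * (R ^ 2 * sin α * (2 - 2 * (σ * R ^ 2) * (1 - cos α)) * (-(3 / 2)) *
      circleKernel σ R α ^ (-(3 / 2 : ℝ) - 1))

lemma one_sub_cos_pos {α : ℝ} (h0 : 0 < α) (h1 : α < 2 * π) : 0 < 1 - cos α := by
  have h : cos α ≠ 1 := fun h ↦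
    h0.ne' ((cos_eq_one_iff_of_lt_of_lt (by linarith [pi_pos]) h1).1 h)
  have := lt_of_le_of_ne (cos_le_one α) h
  linarith

lemma circleKernel_pos {σ R α : ℝ} (hR : 0 < R) (hσR : σ * R ^ 2 ≤ 2 / 5)
    (h0 : 0 < α) (h1 : α < 2 * π) : 0 < circleKernel σ R α := by
  have hy := one_sub_cos_pos h0 h1
  have : 0 < 2 - σ * R ^ 2 * (1 - cos α) := by nlinarith [neg_one_le_cos α]
  unfold circleKernel
  positivity

lemma hasDerivAt_tangentialForce {σ R α : ℝ} (h : circleKernel σ R α ≠ 0) :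
    HasDerivAt (tangentialForce σ R) (tangentialForceDeriv σ R α) α := by
  have hc : HasDerivAt (fun x ↦ 1 - cos x) (sin α) α := by
    simpa using (hasDerivAt_cos α).const_sub 1
  have hk : HasDerivAt (circleKernel σ R)
      (R ^ 2 * sin α * (2 - 2 * (σ * R ^ 2) * (1 - cos α))) α := by
    refine ((hc.const_mul (R ^ 2)).mul ((hc.const_mul (σ * R ^ 2)).const_sub 2)).congr_deriv ?_
    ring
  exact (hasDerivAt_sin α).mul (hk.rpow_const (Or.inl h))

lemma tangentialForceDeriv_neg {σ R α : ℝ} (hR : 0 < R) (hσR : σ * R ^ 2 ≤ 2 / 5)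
    (h0 : 0 < α) (h1 : α < 2 * π) : tangentialForceDeriv σ R α < 0 := by
  have hk := circleKernel_pos hR hσR h0 h1
  have hy := one_sub_cos_pos h0 h1
  have hsplit : circleKernel σ R α ^ (-(3 / 2 : ℝ)) =
      circleKernel σ R α * circleKernel σ R α ^ (-(3 / 2 : ℝ) - 1) := by
    rw [rpow_sub_one hk.ne']
    field_simp
  have hneg : cos α * circleKernel σ R α -
      3 / 2 * (R ^ 2 * sin α ^ 2 * (2 - 2 * (σ * R ^ 2) * (1 - cos α))) < 0 := by
    have hq : 0 < 4 - 5 * (σ * R ^ 2) * (1 - cos α) - (1 - cos α) +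
        2 * (σ * R ^ 2) * (1 - cos α) ^ 2 := by
      have h2 : 0 ≤ (2 / 5 - σ * R ^ 2) * ((1 - cos α) * (5 - 2 * (1 - cos α))) :=
        mul_nonneg (by linarith) (mul_nonneg hy.le (by linarith [neg_one_le_cos α]))
      nlinarith [sq_nonneg (1 - cos α - 15 / 8)]
    have := mul_pos (mul_pos (pow_pos hR 2) hy) hq
    unfold circleKernel
    rw [sin_sq]
    linarith
  have := mul_neg_of_neg_of_pos hneg (rpow_pos_of_pos hk (-(3 / 2 : ℝ) - 1))
  unfold tangentialForceDeriv
  rw [hsplit]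
  linarith

lemma strictAntiOn_tangentialForce {σ R : ℝ} (hR : 0 < R) (hσR : σ * R ^ 2 ≤ 2 / 5) :
    StrictAntiOn (tangentialForce σ R) (Set.Ioo 0 (2 * π)) := by
  have hd : ∀ α ∈ Set.Ioo 0 (2 * π),
      HasDerivAt (tangentialForce σ R) (tangentialForceDeriv σ R α) α := fun α hα ↦
    hasDerivAt_tangentialForce (circleKernel_pos hR hσR hα.1 hα.2).ne'
  refine strictAntiOn_of_deriv_neg (convex_Ioo _ _)
    (fun α hα ↦ (hd α hα).continuousAt.continuousWithinAt) fun α hα ↦ ?_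
  rw [interior_Ioo] at hα
  rw [(hd α hα).deriv]
  exact tangentialForceDeriv_neg hR hσR hα.1 hα.2

lemma tangentialForce_add_two_pi (σ R α : ℝ) :
    tangentialForce σ R (α + 2 * π) = tangentialForce σ R α := by
  simp [tangentialForce, circleKernel]

lemma tangentialForce_add_nat_mul_two_pi (σ R α : ℝ) (k : ℕ) :
    tangentialForce σ R (α + k * (2 * π)) = tangentialForce σ R α := by
  simp [tangentialForce, circleKernel, cos_add_nat_mul_two_pi, sin_add_nat_mul_two_pi]

/-- Along two continuous angle functions with values in `(0, 2π)`, the tangential force is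
Lipschitz on compact time intervals. -/
lemma exists_abs_tangentialForce_sub_le {σ : ℝ} {r A B : ℝ → ℝ} (hr : Continuous r)
    (hr_pos : ∀ t, 0 < r t) (hσr : ∀ t, σ * r t ^ 2 ≤ 2 / 5)
    (hA : Continuous A) (hB : Continuous B)
    (hA' : ∀ t, A t ∈ Set.Ioo 0 (2 * π)) (hB' : ∀ t, B t ∈ Set.Ioo 0 (2 * π)) (a b : ℝ) :
    ∃ L, 0 ≤ L ∧ ∀ t ∈ Set.Icc a b,
      |tangentialForce σ (r t) (A t) - tangentialForce σ (r t) (B t)| ≤ L * |A t - B t| := by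
  have hseg : ∀ t, ∀ s ∈ Set.Icc (0 : ℝ) 1, B t + s * (A t - B t) ∈ Set.Ioo 0 (2 * π) :=
    fun t s hs ↦ (convex_Ioo _ _).add_smul_sub_mem (hB' t) (hA' t) hs
  have hcont : ContinuousOn
      (fun p : ℝ × ℝ ↦ tangentialForceDeriv σ (r p.1) (B p.1 + p.2 * (A p.1 - B p.1)))
      (Set.Icc a b ×ˢ Set.Icc 0 1) := by
    have hk : Continuous
        (fun p : ℝ × ℝ ↦ circleKernel σ (r p.1) (B p.1 + p.2 * (A p.1 - B p.1))) := by
      unfold circleKernel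
      fun_prop
    have hkp : ∀ e : ℝ, ContinuousOn
        (fun p : ℝ × ℝ ↦ circleKernel σ (r p.1) (B p.1 + p.2 * (A p.1 - B p.1)) ^ e)
        (Set.Icc a b ×ˢ Set.Icc 0 1) := fun e ↦
      hk.continuousOn.rpow_const fun p hp ↦ Or.inl
        (circleKernel_pos (hr_pos _) (hσr _) (hseg _ _ hp.2).1 (hseg _ _ hp.2).2).ne'
    unfold tangentialForceDeriv
    have h1 := hkp (-(3 / 2 : ℝ))
    have h2 := hkp (-(3 / 2 : ℝ) - 1)
    fun_prop
  obtain ⟨L, hL⟩ := (isCompact_Icc.prod isCompact_Icc).exists_bound_of_continuousOn hcont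
  refine ⟨max L 0, le_max_right _ _, fun t ht ↦ ?_⟩
  have hline : ∀ s ∈ Set.Icc (0 : ℝ) 1, HasDerivWithinAt
      (fun s ↦ tangentialForce σ (r t) (B t + s * (A t - B t)))
      (tangentialForceDeriv σ (r t) (B t + s * (A t - B t)) * (A t - B t)) (Set.Icc 0 1) s := by
    intro s hs
    have hin : HasDerivAt (fun s ↦ B t + s * (A t - B t)) (A t - B t) s := by
      simpa using ((hasDerivAt_id s).mul_const (A t - B t)).const_add (B t)
    exact ((hasDerivAt_tangentialForce (circleKernel_pos (hr_pos t) (hσr t) (hseg t s hs).1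
      (hseg t s hs).2).ne').comp s hin).hasDerivWithinAt
  have := (convex_Icc (0 : ℝ) 1).norm_image_sub_le_of_norm_hasDerivWithin_le hline
    (C := max L 0 * |A t - B t|) (fun s hs ↦ by
      rw [norm_mul]
      exact mul_le_mul_of_nonneg_right ((hL (t, s) ⟨ht, hs⟩).trans (le_max_left _ _))
        (norm_nonneg _))
    (Set.left_mem_Icc.2 zero_le_one) (Set.right_mem_Icc.2 zero_le_one)
  simpa using this

/-- A Grönwall-type uniqueness statement on the whole line. -/
lemma eq_zero_of_norm_deriv_le_mul_norm {E : Type*} [NormedAddCommGroup E] [NormedSpace ℝ E]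
    {f f' : ℝ → E} {t₀ : ℝ} (hf : ∀ t, HasDerivAt f (f' t) t) (h0 : f t₀ = 0)
    (hb : ∀ a b, ∃ K, ∀ t ∈ Set.Icc a b, ‖f' t‖ ≤ K * ‖f t‖) (t : ℝ) : f t = 0 := by
  rcases le_total t₀ t with h | h
  · obtain ⟨K, hK⟩ := hb t₀ t
    exact eq_zero_of_abs_deriv_le_mul_abs_self_of_eq_zero_right
      (fun s _ ↦ (hf s).continuousAt.continuousWithinAt) (fun s _ ↦ (hf s).hasDerivWithinAt) h0
      (fun s hs ↦ hK s (Set.Ico_subset_Icc_self hs)) t (Set.right_mem_Icc.2 h)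
  · obtain ⟨K, hK⟩ := hb t t₀
    have hg : ∀ s, HasDerivAt (fun s ↦ f (-s)) (-f' (-s)) s := fun s ↦ by
      have := (hf (-s)).scomp s (hasDerivAt_neg s)
      rwa [neg_one_smul] at this
    have := eq_zero_of_abs_deriv_le_mul_abs_self_of_eq_zero_right (a := -t₀) (b := -t) (K := K)
      (fun s _ ↦ (hg s).continuousAt.continuousWithinAt) (fun s _ ↦ (hg s).hasDerivWithinAt)
      (by simpa using h0)
      (fun s hs ↦ by
        rw [norm_neg]
        exact hK (-s) ⟨by linarith [hs.2], by linarith [hs.1]⟩) (-t)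
      (Set.right_mem_Icc.2 (neg_le_neg h))
    simpa using this

/-- The second-derivative necessary condition at a local minimum. -/
lemma IsLocalMin.deriv_deriv_nonneg {f : ℝ → ℝ} {t₀ : ℝ} (h : IsLocalMin f t₀)
    (hf : ContinuousAt f t₀) : 0 ≤ deriv (deriv f) t₀ := by
  by_contra! hneg
  have hmax := isLocalMax_of_deriv_deriv_neg hneg h.deriv_eq_zero hf
  have hconst : f =ᶠ[nhds t₀] fun _ ↦ f t₀ := by
    filter_upwards [h, hmax] with t h1 h2 using le_antisymm h2 h1
  have := hconst.deriv.deriv_eq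
  simp at this
  linarith

lemma sum_range_add_of_periodic {n : ℕ} {g : ℕ → ℝ} (hg : ∀ k, g (k + n) = g k) (i : ℕ) :
    ∑ l ∈ Finset.range n, g (i + l) = ∑ l ∈ Finset.range n, g l := by
  induction i with
  | zero => simp
  | succ i ih =>
    rw [← ih, ← add_left_inj (g i)]
    have h1 := Finset.sum_range_succ (fun l ↦ g (i + l)) n
    have h2 := Finset.sum_range_succ' (fun l ↦ g (i + l)) n
    simp only [hg, add_zero] at h1 h2
    rw [← h1, h2]
    simp only [add_assoc, add_comm 1]

/-- The system of equations for angles `Θ k`, `k : ℕ`, with `Θ (k + n) = Θ k + 2π`: the tangential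
part of the equations of motion of a circular solution with `n` equal masses. -/
structure IsAngularSolution (n : ℕ) (σ m : ℝ) (r : ℝ → ℝ) (Θ : ℕ → ℝ → ℝ) : Prop where
  contDiff : ∀ k, ContDiff ℝ 2 (Θ k)
  lt_succ : ∀ k t, Θ k t < Θ (k + 1) t
  add_period : ∀ k t, Θ (k + n) t = Θ k t + 2 * π
  deriv_deriv : ∀ k t, deriv (deriv (Θ k)) t = -2 * deriv r t / r t * deriv (Θ k) t +
    m * ∑ l ∈ Finset.range (n - 1), tangentialForce σ (r t) (Θ (k + l + 1) t - Θ k t)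

namespace IsAngularSolution

variable {n : ℕ} {σ m : ℝ} {r : ℝ → ℝ} {Θ : ℕ → ℝ → ℝ}

lemma differentiable (h : IsAngularSolution n σ m r Θ) (k : ℕ) : Differentiable ℝ (Θ k) :=
  (h.contDiff k).differentiable two_ne_zero

lemma differentiable_deriv (h : IsAngularSolution n σ m r Θ) (k : ℕ) :
    Differentiable ℝ (deriv (Θ k)) :=
  (contDiff_succ_iff_deriv.1 (h.contDiff k)).2.2.differentiable one_ne_zero

lemma strictMono (h : IsAngularSolution n σ m r Θ) (t : ℝ) : StrictMono fun k ↦ Θ k t :=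
  strictMono_nat_of_lt_succ fun k ↦ h.lt_succ k t

lemma sub_mem_Ioo (h : IsAngularSolution n σ m r Θ) (k : ℕ) {l : ℕ} (hl : l + 1 < n) (t : ℝ) :
    Θ (k + l + 1) t - Θ k t ∈ Set.Ioo 0 (2 * π) := by
  have h1 : Θ k t < Θ (k + l + 1) t := h.strictMono t (by omega)
  have h2 : Θ (k + l + 1) t < Θ (k + n) t := h.strictMono t (by omega)
  rw [h.add_period] at h2
  exact ⟨by linarith, by linarith⟩

lemma gap_mod (h : IsAngularSolution n σ m r Θ) (k : ℕ) (t : ℝ) :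
    Θ (k % n + 1) t - Θ (k % n) t = Θ (k + 1) t - Θ k t := by
  have hper : Function.Periodic (fun k ↦ Θ (k + 1) t - Θ k t) n := fun k ↦ by
    simp only [add_right_comm k n 1, h.add_period]
    ring
  exact hper.map_mod_nat k

/-- If a smallest gap has a local minimum, then at that time all gaps are equal to it. -/
lemma gap_eq_of_isLocalMin (h : IsAngularSolution n σ m r Θ) (hn : 2 ≤ n) (hm : 0 < m)
    (hr_pos : ∀ t, 0 < r t) (hσr : ∀ t, σ * r t ^ 2 ≤ 2 / 5) {t₀ : ℝ} {k : ℕ}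
    (hk : ∀ j, Θ (k + 1) t₀ - Θ k t₀ ≤ Θ (j + 1) t₀ - Θ j t₀)
    (hmin : IsLocalMin (fun t ↦ Θ (k + 1) t - Θ k t) t₀) (j : ℕ) :
    Θ (j + 1) t₀ - Θ j t₀ = Θ (k + 1) t₀ - Θ k t₀ := by
  have hd : deriv (fun t ↦ Θ (k + 1) t - Θ k t) = fun t ↦ deriv (Θ (k + 1)) t - deriv (Θ k) t :=
    funext fun t ↦ deriv_fun_sub (h.differentiable _ t) (h.differentiable _ t)
  have h1 : deriv (Θ (k + 1)) t₀ - deriv (Θ k) t₀ = 0 := by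
    simpa only [hd] using hmin.deriv_eq_zero
  have h2 := hmin.deriv_deriv_nonneg
    ((h.differentiable (k + 1)).sub (h.differentiable k)).continuous.continuousAt
  rw [hd, deriv_fun_sub (h.differentiable_deriv _ t₀) (h.differentiable_deriv _ t₀),
    h.deriv_deriv, h.deriv_deriv, sub_eq_zero.1 h1, add_sub_add_left_eq_sub, ← mul_sub] at h2
  have hsum := sub_nonneg.1 (nonneg_of_mul_nonneg_right h2 hm)
  have hanti := strictAntiOn_tangentialForce (hr_pos t₀) (hσr t₀)
  have hle : ∀ l, Θ (k + l + 1) t₀ - Θ k t₀ ≤ Θ (k + 1 + l + 1) t₀ - Θ (k + 1) t₀ := fun l ↦ by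
    have := hk (k + l + 1)
    rw [show k + 1 + l + 1 = k + l + 1 + 1 by ring]
    linarith
  have hF : ∀ l ∈ Finset.range (n - 1),
      tangentialForce σ (r t₀) (Θ (k + 1 + l + 1) t₀ - Θ (k + 1) t₀) ≤
        tangentialForce σ (r t₀) (Θ (k + l + 1) t₀ - Θ k t₀) := fun l hl ↦ by
    have hl' : l + 1 < n := by have := Finset.mem_range.1 hl; omega
    exact hanti.antitoneOn (h.sub_mem_Ioo k hl' t₀) (h.sub_mem_Ioo (k + 1) hl' t₀) (hle l)
  have heq := (Finset.sum_eq_sum_iff_of_le hF).1 (le_antisymm (Finset.sum_le_sum hF) hsum)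
  have hgap : ∀ l < n - 1, Θ (k + l + 1 + 1) t₀ - Θ (k + l + 1) t₀ = Θ (k + 1) t₀ - Θ k t₀ := by
    intro l hl
    have hl' : l + 1 < n := by omega
    have := hanti.injOn (h.sub_mem_Ioo (k + 1) hl' t₀) (h.sub_mem_Ioo k hl' t₀)
      (heq l (Finset.mem_range.2 hl))
    rw [show k + 1 + l + 1 = k + l + 1 + 1 by ring] at this
    linarith
  have hj : ∃ l < n, (k + l) % n = j % n := by
    refine ⟨(j + (n - k % n)) % n, Nat.mod_lt _ (by omega), ?_⟩
    have hkn : k % n < n := Nat.mod_lt _ (by omega)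
    rw [Nat.add_mod_mod, ← Nat.mod_add_mod, show k % n + (j + (n - k % n)) = j + n by omega,
      Nat.add_mod_right]
  obtain ⟨l, hl, hlj⟩ := hj
  rw [← h.gap_mod j, ← hlj, h.gap_mod]
  cases l with
  | zero => rfl
  | succ l => exact hgap l (by omega)

/-- The deviation of the configuration from the regular polygon through `Θ 0`. -/
lemma deviation_mod (h : IsAngularSolution n σ m r Θ) (hn : n ≠ 0) (k : ℕ) (t : ℝ) :
    Θ (k % n) t - Θ 0 t - 2 * π * (k % n : ℕ) / n = Θ k t - Θ 0 t - 2 * π * k / n := by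
  have hper : Function.Periodic (fun k : ℕ ↦ Θ k t - Θ 0 t - 2 * π * k / n) n := fun k ↦ by
    simp only [h.add_period]
    push_cast
    field_simp
    ring
  exact hper.map_mod_nat k

/-- A configuration which is a regular polygon with a common angular velocity at one time is a
regular polygon forever. -/
lemma eq_add_of_initial (h : IsAngularSolution n σ m r Θ) (hn : n ≠ 0)
    (hr : ContDiff ℝ 2 r) (hr_pos : ∀ t, 0 < r t) (hσr : ∀ t, σ * r t ^ 2 ≤ 2 / 5) {t₀ : ℝ}
    (h0 : ∀ k, Θ k t₀ = Θ 0 t₀ + 2 * π * k / n) (h1 : ∀ k, deriv (Θ k) t₀ = deriv (Θ 0) t₀)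
    (t : ℝ) {k : ℕ} (hk : k < n) : Θ k t = Θ 0 t + 2 * π * k / n := by
  set e : ℕ → ℝ → ℝ := fun k t ↦ Θ k t - Θ 0 t - 2 * π * k / n with he
  set e' : ℕ → ℝ → ℝ := fun k t ↦ deriv (Θ k) t - deriv (Θ 0) t with he'
  set e'' : ℕ → ℝ → ℝ := fun k t ↦ deriv (deriv (Θ k)) t - deriv (deriv (Θ 0)) t with he''
  have hde : ∀ k t, HasDerivAt (e k) (e' k t) t := fun k t ↦
    ((h.differentiable k t).hasDerivAt.sub (h.differentiable 0 t).hasDerivAt).sub_const _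
  have hde' : ∀ k t, HasDerivAt (e' k) (e'' k t) t := fun k t ↦
    (h.differentiable_deriv k t).hasDerivAt.sub (h.differentiable_deriv 0 t).hasDerivAt
  set f : ℝ → (Fin n → ℝ) × (Fin n → ℝ) := fun t ↦ (fun i ↦ e i t, fun i ↦ e' i t) with hf
  have hnorm : ∀ t k, |e k t| ≤ ‖f t‖ := fun t k ↦ by
    have hkn : k % n < n := Nat.mod_lt _ (Nat.pos_of_ne_zero hn)
    have := (norm_le_pi_norm (f t).1 ⟨k % n, hkn⟩).trans (norm_fst_le (f t))
    simpa only [hf, he, h.deviation_mod hn, norm_eq_abs] using this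
  have hnorm' : ∀ t (i : Fin n), |e' i t| ≤ ‖f t‖ := fun t i ↦
    (norm_le_pi_norm (f t).2 i).trans (norm_snd_le (f t))
  have hzero : f t = 0 := by
    refine eq_zero_of_norm_deriv_le_mul_norm (t₀ := t₀)
      (f' := fun t ↦ (fun i : Fin n ↦ e' i t, fun i : Fin n ↦ e'' i t))
      (fun t ↦ (hasDerivAt_pi.2 fun i : Fin n ↦ hde i t).prodMk
        (hasDerivAt_pi.2 fun i : Fin n ↦ hde' i t))
      ?_ (fun a b ↦ ?_) t
    · exact Prod.ext (funext fun i ↦ sub_eq_zero.2 (sub_eq_iff_eq_add'.2 (h0 i)))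
        (funext fun i ↦ sub_eq_zero.2 (h1 i))
    have hdamp : ContinuousOn (fun t ↦ -2 * deriv r t / r t) (Set.Icc a b) :=
      ((continuous_const.mul (hr.continuous_deriv one_le_two)).div hr.continuous
        fun t ↦ (hr_pos t).ne').continuousOn
    obtain ⟨C, hC⟩ := isCompact_Icc.exists_bound_of_continuousOn hdamp
    have hlip : ∀ (i : Fin n) (l : Fin (n - 1)), ∃ L, 0 ≤ L ∧ ∀ t ∈ Set.Icc a b,
        |tangentialForce σ (r t) (Θ (i + l + 1) t - Θ i t) -
          tangentialForce σ (r t) (Θ (0 + l + 1) t - Θ 0 t)| ≤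
        L * |(Θ (i + l + 1) t - Θ i t) - (Θ (0 + l + 1) t - Θ 0 t)| := fun i l ↦
      exists_abs_tangentialForce_sub_le hr.continuous hr_pos hσr
        ((h.contDiff _).continuous.sub (h.contDiff _).continuous)
        ((h.contDiff _).continuous.sub (h.contDiff _).continuous)
        (h.sub_mem_Ioo _ (by omega)) (h.sub_mem_Ioo _ (by omega)) a b
    choose L hL0 hL using hlip
    set S : ℝ := ∑ i, ∑ l, L i l * 3 with hS
    have hS0 : 0 ≤ S := Finset.sum_nonneg fun i _ ↦ Finset.sum_nonneg fun l _ ↦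
      mul_nonneg (hL0 i l) (by norm_num)
    refine ⟨1 + |C| + |m| * S, fun t ht ↦ ?_⟩
    have hK : 0 ≤ |C| + |m| * S := by positivity
    have hft := norm_nonneg (f t)
    have hbound : ∀ i : Fin n, |e'' i t| ≤ (|C| + |m| * S) * ‖f t‖ := fun i ↦ by
      have hsplit : e'' i t = -2 * deriv r t / r t * e' i t + m * ∑ l : Fin (n - 1),
          (tangentialForce σ (r t) (Θ (i + l + 1) t - Θ i t) -
            tangentialForce σ (r t) (Θ (0 + l + 1) t - Θ 0 t)) := by
        simp only [he'', he', h.deriv_deriv, Finset.sum_sub_distrib,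
          Finset.sum_range (n := n - 1)]
        ring
      have hsum : |∑ l : Fin (n - 1),
          (tangentialForce σ (r t) (Θ (i + l + 1) t - Θ i t) -
            tangentialForce σ (r t) (Θ (0 + l + 1) t - Θ 0 t))| ≤ S * ‖f t‖ := by
        calc _ ≤ ∑ l, L i l * 3 * ‖f t‖ := by
              refine (Finset.abs_sum_le_sum_abs _ _).trans (Finset.sum_le_sum fun l _ ↦ ?_)
              refine (hL i l t ht).trans ?_
              rw [mul_assoc]
              refine mul_le_mul_of_nonneg_left ?_ (hL0 i l)
              have heq : (Θ (i + l + 1) t - Θ i t) - (Θ (0 + l + 1) t - Θ 0 t) =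
                  e (i + l + 1) t - e i t - e (0 + l + 1) t := by
                simp only [he]
                push_cast
                ring
              rw [heq]
              have b1 := abs_le.1 (hnorm t (i + l + 1))
              have b2 := abs_le.1 (hnorm t i)
              have b3 := abs_le.1 (hnorm t (0 + l + 1))
              exact abs_le.2 ⟨by linarith, by linarith⟩
          _ = (∑ l, L i l * 3) * ‖f t‖ := (Finset.sum_mul _ _ _).symm
          _ ≤ S * ‖f t‖ := mul_le_mul_of_nonneg_right
              (Finset.single_le_sum (f := fun i ↦ ∑ l, L i l * 3)
                (fun i _ ↦ Finset.sum_nonneg fun l _ ↦ mul_nonneg (hL0 i l) (by norm_num))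
                (Finset.mem_univ i)) hft
      calc |e'' i t| ≤ |-2 * deriv r t / r t| * |e' i t| + |m| * _ := by
            rw [hsplit, ← abs_mul, ← abs_mul]
            exact abs_add_le _ _
        _ ≤ |C| * ‖f t‖ + |m| * (S * ‖f t‖) :=
            add_le_add (mul_le_mul ((hC t ht).trans (le_abs_self C)) (hnorm' t i) (abs_nonneg _)
              (abs_nonneg _)) (mul_le_mul_of_nonneg_left hsum (abs_nonneg _))
        _ = _ := by ring
    refine norm_prod_le_iff.2 ⟨(pi_norm_le_iff_of_nonneg (by positivity)).2 fun i ↦ ?_,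
      (pi_norm_le_iff_of_nonneg (by positivity)).2 fun i ↦ ?_⟩
    · exact (hnorm' t i).trans (by nlinarith)
    · exact (hbound i).trans (by nlinarith)
  have := congr_fun (congr_arg Prod.fst hzero) ⟨k, hk⟩
  simp only [hf, he, Prod.fst_zero, Pi.zero_apply] at this
  linarith

/-- If the minimal gap of an angular solution has a local minimum, the configuration is a regular
polygon at all times. -/
lemma eq_add_of_isLocalMin (h : IsAngularSolution n σ m r Θ) (hn : 2 ≤ n) (hm : 0 < m)
    (hr : ContDiff ℝ 2 r) (hr_pos : ∀ t, 0 < r t) (hσr : ∀ t, σ * r t ^ 2 ≤ 2 / 5) {t₀ : ℝ}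
    (hne : (Finset.range n).Nonempty)
    (hmin : IsLocalMin (fun t ↦ (Finset.range n).inf' hne fun j ↦ Θ (j + 1) t - Θ j t) t₀)
    (t : ℝ) {k : ℕ} (hk : k < n) : Θ k t = Θ 0 t + 2 * π * k / n := by
  have hn0 : n ≠ 0 := by omega
  have hle : ∀ j t, ((Finset.range n).inf' hne fun j ↦ Θ (j + 1) t - Θ j t) ≤
      Θ (j + 1) t - Θ j t := fun j t ↦ by
    rw [← h.gap_mod j]
    exact Finset.inf'_le (fun j ↦ Θ (j + 1) t - Θ j t)
      (Finset.mem_range.2 (Nat.mod_lt _ (Nat.pos_of_ne_zero hn0)))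
  have hloc : ∀ j, Θ (j + 1) t₀ - Θ j t₀ =
      ((Finset.range n).inf' hne fun j ↦ Θ (j + 1) t₀ - Θ j t₀) →
      IsLocalMin (fun t ↦ Θ (j + 1) t - Θ j t) t₀ := fun j hj ↦ by
    filter_upwards [hmin] with t ht
    exact (hj.trans_le ht).trans (hle j t)
  obtain ⟨j₀, -, hj₀⟩ := Finset.exists_mem_eq_inf' hne fun j ↦ Θ (j + 1) t₀ - Θ j t₀
  have hgap := h.gap_eq_of_isLocalMin hn hm hr_pos hσr (fun j ↦ hj₀ ▸ hle j t₀) (hloc j₀ hj₀.symm)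
  set d := Θ (j₀ + 1) t₀ - Θ j₀ t₀
  have hlin : ∀ k : ℕ, Θ k t₀ = Θ 0 t₀ + k * d := fun k ↦ by
    induction k with
    | zero => simp
    | succ k ih =>
      push_cast
      linarith [hgap k]
  have hd : d = 2 * π / n := by
    have h1 := h.add_period 0 t₀
    rw [zero_add, hlin n] at h1
    field_simp
    linarith
  refine h.eq_add_of_initial hn0 hr hr_pos hσr (t₀ := t₀) (fun k ↦ ?_) (fun k ↦ ?_) t hk
  · rw [hlin k, hd]
    ring
  · induction k with
    | zero => rfl
    | succ k ih =>
      have hk' := (hloc k ((hgap k).trans hj₀.symm)).deriv_eq_zero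
      rw [deriv_fun_sub (h.differentiable _ t₀) (h.differentiable _ t₀)] at hk'
      linarith

end IsAngularSolution

lemma sub_odot_sq_eq_circleKernel {σ R Z : ℝ} (hσ : σ = 1 ∨ σ = -1) (h : R ^ 2 + σ * Z ^ 2 = σ)
    (a b : ℝ) :
    σ - σ * odot σ (R * cos a, R * sin a, Z) (R * cos b, R * sin b, Z) ^ 2 =
      circleKernel σ R (b - a) := by
  have ho : odot σ (R * cos a, R * sin a, Z) (R * cos b, R * sin b, Z) =
      σ - R ^ 2 * (1 - cos (b - a)) := by
    rw [cos_sub]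
    simp only [odot]
    linear_combination h
  have hσ2 : σ ^ 2 = 1 := by rcases hσ with rfl | rfl <;> norm_num
  rw [ho, circleKernel]
  linear_combination (2 * R ^ 2 * (1 - cos (b - a)) - σ) * hσ2

/-- The tangential part of the equations of motion of a circular solution. -/
lemma deriv_deriv_angle_eq {n : ℕ} {σ m : ℝ} (hσ : σ = 1 ∨ σ = -1) {r z : ℝ → ℝ}
    (hr : ContDiff ℝ 2 r) (hr_pos : ∀ t, 0 < r t) (hz : ContDiff ℝ 2 z)
    (hsphere : ∀ t, r t ^ 2 + σ * z t ^ 2 = σ)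
    {θ : ℕ → ℝ → ℝ} (hθ : ∀ i < n, ContDiff ℝ 2 (θ i)) {q : ℕ → ℝ → ℝ × ℝ × ℝ}
    (hq : ∀ i < n, ∀ t, q i t = (r t * cos (θ i t), r t * sin (θ i t), z t))
    (hODE : ∀ i < n, ∀ t, deriv (deriv (q i)) t =
      (∑ j ∈ (Finset.range n).erase i,
        (m * (σ - σ * (odot σ (q i t) (q j t)) ^ 2) ^ (-(3 / 2 : ℝ))) •
          (q j t - (σ * odot σ (q i t) (q j t)) • q i t))
      - (σ * odot σ (deriv (q i) t) (deriv (q i) t)) • q i t)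
    {i : ℕ} (hi : i < n) (t : ℝ) :
    deriv (deriv (θ i)) t = -2 * deriv r t / r t * deriv (θ i) t +
      m * ∑ j ∈ Finset.range n, tangentialForce σ (r t) (θ j t - θ i t) := by
  have hd : ∀ {f : ℝ → ℝ}, ContDiff ℝ 2 f →
      (∀ s, HasDerivAt f (deriv f s) s) ∧ ∀ s, HasDerivAt (deriv f) (deriv (deriv f) s) s :=
    fun hf ↦ ⟨fun s ↦ (hf.differentiable two_ne_zero s).hasDerivAt, fun s ↦
      ((contDiff_succ_iff_deriv.1 hf).2.2.differentiable one_ne_zero s).hasDerivAt⟩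
  obtain ⟨hr1, hr2⟩ := hd hr
  obtain ⟨hz1, hz2⟩ := hd hz
  obtain ⟨hθ1, hθ2⟩ := hd (hθ i hi)
  have hqi : q i = fun s ↦ (r s * cos (θ i s), r s * sin (θ i s), z s) := funext (hq i hi)
  have hq1 : deriv (q i) = fun s ↦
      (deriv r s * cos (θ i s) + r s * (-sin (θ i s) * deriv (θ i) s),
        deriv r s * sin (θ i s) + r s * (cos (θ i s) * deriv (θ i) s), deriv z s) := by
    rw [hqi]
    exact funext fun s ↦ (((hr1 s).mul (hθ1 s).cos).prodMk
      (((hr1 s).mul (hθ1 s).sin).prodMk (hz1 s))).deriv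
  have hq2 := ((((hr2 t).mul (hθ1 t).cos).add ((hr1 t).mul ((hθ1 t).sin.neg.mul (hθ2 t)))).prodMk
    ((((hr2 t).mul (hθ1 t).sin).add ((hr1 t).mul ((hθ1 t).cos.mul (hθ2 t)))).prodMk (hz2 t)))
  have hq2 : deriv (deriv (q i)) t = _ := (congr_arg (deriv · t) hq1).trans hq2.deriv
  have htan : -sin (θ i t) * (deriv (deriv (q i)) t).1 +
      cos (θ i t) * (deriv (deriv (q i)) t).2.1 =
      m * r t * ∑ j ∈ Finset.range n, tangentialForce σ (r t) (θ j t - θ i t) := by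
    have hself : tangentialForce σ (r t) (θ i t - θ i t) = 0 := by simp [tangentialForce]
    have hterm : ∀ j ∈ (Finset.range n).erase i, m * r t * tangentialForce σ (r t) (θ j t - θ i t) =
        -sin (θ i t) * ((m * (σ - σ * (odot σ (q i t) (q j t)) ^ 2) ^ (-(3 / 2 : ℝ))) •
          (q j t - (σ * odot σ (q i t) (q j t)) • q i t)).1 +
        cos (θ i t) * ((m * (σ - σ * (odot σ (q i t) (q j t)) ^ 2) ^ (-(3 / 2 : ℝ))) •
          (q j t - (σ * odot σ (q i t) (q j t)) • q i t)).2.1 := fun j hj ↦ by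
      have hjn : j < n := Finset.mem_range.1 (Finset.mem_of_mem_erase hj)
      rw [hq i hi, hq j hjn, sub_odot_sq_eq_circleKernel hσ (hsphere t), tangentialForce, sin_sub]
      simp only [Prod.fst_sub, Prod.snd_sub, Prod.smul_fst, Prod.smul_snd, smul_eq_mul]
      ring
    rw [hODE i hi t, ← Finset.add_sum_erase _ _ (Finset.mem_range.2 hi), hself, zero_add,
      Finset.mul_sum, Finset.sum_congr rfl hterm, Finset.sum_add_distrib, ← Finset.mul_sum,
      ← Finset.mul_sum, ← Prod.fst_sum, ← Prod.fst_sum, ← Prod.snd_sum]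
    simp only [Prod.fst_sub, Prod.snd_sub, Prod.smul_fst, Prod.smul_snd, smul_eq_mul, hq i hi t]
    ring
  rw [hq2] at htan
  simp only [Pi.neg_apply, Pi.mul_apply] at htan
  have hr0 := (hr_pos t).ne'
  field_simp
  linear_combination htan - (r t * deriv (deriv (θ i)) t + 2 * deriv r t * deriv (θ i) t) *
    sin_sq_add_cos_sq (θ i t)

/-- The extension of `n` ordered angles to a family indexed by `ℕ`, advancing by `2π` with each
period. -/
noncomputable def liftAngle (n : ℕ) (θ : ℕ → ℝ → ℝ) (k : ℕ) (t : ℝ) : ℝ :=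
  θ (k % n) t + (k / n : ℕ) * (2 * π)

lemma liftAngle_of_lt {n k : ℕ} (θ : ℕ → ℝ → ℝ) (hk : k < n) : liftAngle n θ k = θ k := by
  ext t
  simp [liftAngle, Nat.mod_eq_of_lt hk, Nat.div_eq_of_lt hk]

lemma liftAngle_add_period {n : ℕ} (hn : 0 < n) (θ : ℕ → ℝ → ℝ) (k : ℕ) (t : ℝ) :
    liftAngle n θ (k + n) t = liftAngle n θ k t + 2 * π := by
  simp only [liftAngle, Nat.add_mod_right, Nat.add_div_right k hn]
  push_cast
  ring

lemma liftAngle_succ_sub {n : ℕ} (hn : 2 ≤ n) (θ : ℕ → ℝ → ℝ) (k : ℕ) (t : ℝ) :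
    liftAngle n θ (k + 1) t - liftAngle n θ k t =
      (if k % n + 1 = n then θ 0 t + 2 * π else θ (k % n + 1) t) - θ (k % n) t := by
  have hk := Nat.mod_lt k (by omega : n > 0)
  obtain ⟨d, hd⟩ : ∃ d, k = k % n + n * d := ⟨k / n, (Nat.mod_add_div k n).symm⟩
  have hkd : k / n = d := by
    conv_lhs => rw [hd]
    rw [Nat.add_mul_div_left _ _ (by omega), Nat.div_eq_of_lt hk, zero_add]
  split_ifs with h
  · have h1 : k + 1 = n * (d + 1) := by rw [mul_add, mul_one]; omega
    rw [liftAngle, liftAngle, hkd, h1, Nat.mul_mod_right, Nat.mul_div_cancel_left _ (by omega)]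
    push_cast
    ring
  · have h1 : k + 1 = k % n + 1 + n * d := by omega
    have hk1 : k % n + 1 < n := by omega
    have h2 : (k + 1) % n = k % n + 1 := by
      rw [h1, Nat.add_mul_mod_self_left, Nat.mod_eq_of_lt hk1]
    have h3 : (k + 1) / n = d := by
      rw [h1, Nat.add_mul_div_left _ _ (by omega), Nat.div_eq_of_lt hk1, zero_add]
    rw [liftAngle, liftAngle, hkd, h2, h3]
    ring

lemma sum_tangentialForce_liftAngle {n : ℕ} (hn : 0 < n) (σ R : ℝ) (θ : ℕ → ℝ → ℝ) (k : ℕ)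
    (t : ℝ) :
    ∑ l ∈ Finset.range (n - 1),
        tangentialForce σ R (liftAngle n θ (k + l + 1) t - liftAngle n θ k t) =
      ∑ j ∈ Finset.range n, tangentialForce σ R (θ j t - θ (k % n) t) := by
  set g : ℕ → ℝ := fun j ↦ tangentialForce σ R (liftAngle n θ j t - θ (k % n) t) with hg
  have hk : ∀ j, tangentialForce σ R (liftAngle n θ j t - liftAngle n θ k t) = g j := fun j ↦ by
    rw [hg, ← tangentialForce_add_nat_mul_two_pi σ R _ (k / n)]
    simp only [liftAngle]
    ring_nf
  have hper : ∀ j, g (j + n) = g j := fun j ↦ by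
    simp only [hg, liftAngle_add_period hn, add_sub_right_comm, tangentialForce_add_two_pi]
  have hgk : g k = 0 := by rw [← hk]; simp [tangentialForce]
  have hsum := Finset.sum_range_succ' (fun l ↦ g (k + l)) (n - 1)
  rw [Nat.sub_add_cancel hn, sum_range_add_of_periodic hper, add_zero, hgk, add_zero] at hsum
  simp only [hk, add_assoc]
  rw [← hsum]
  exact Finset.sum_congr rfl fun j hj ↦ by
    rw [hg]
    simp only [liftAngle_of_lt θ (Finset.mem_range.1 hj)]

/-- A circular solution of the curved `n`-body problem on `M_σ²` with all
masses equal to a constant `m > 0`, with `σ = -1`, or `σ = 1` and `r < √10/5`, whose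
minimal angular gap `μ₁` has a local minimum at some time `t₀`, is a polygonal
rotopulsator with a regular polygon configuration.
Bodies are indexed by `i ∈ {0, …, n-1}`. -/
theorem curved_circular_equal_masses_is_regular_rotopulsator
    (n : ℕ) (hn : 2 ≤ n)
    (σ : ℝ) (hσ : σ = 1 ∨ σ = -1)
    -- the common (constant) mass
    (m : ℝ) (hm : 0 < m)
    -- the radius, twice continuously differentiable and positive
    (r : ℝ → ℝ) (hr : ContDiff ℝ 2 r) (hr_pos : ∀ t, 0 < r t)
    -- the third coordinate, twice continuously differentiable, with `r² + σz² = σ`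
    (z : ℝ → ℝ) (hz : ContDiff ℝ 2 z) (hsphere : ∀ t, r t ^ 2 + σ * z t ^ 2 = σ)
    -- either `σ = -1`, or `σ = 1` and `r < √10/5` everywhere
    (hcase : σ = -1 ∨ (σ = 1 ∧ ∀ t, r t < Real.sqrt 10 / 5))
    -- the angles, twice continuously differentiable and ordered
    (θ : ℕ → ℝ → ℝ) (hθ : ∀ i < n, ContDiff ℝ 2 (θ i))
    (hord : ∀ t, ∀ i j, i < j → j < n → θ i t < θ j t)
    (hord2 : ∀ t, ∀ i < n, θ i t < θ 0 t + 2 * π)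
    -- the bodies, lying on a circle of radius `r` at height `z` in `M_σ²`
    (q : ℕ → ℝ → ℝ × ℝ × ℝ)
    (hq : ∀ i < n, ∀ t,
      q i t = (r t * Real.cos (θ i t), r t * Real.sin (θ i t), z t))
    -- the curved equations of motion
    (hODE : ∀ i < n, ∀ t, deriv (deriv (q i)) t =
      (∑ j ∈ (Finset.range n).erase i,
        (m * (σ - σ * (odot σ (q i t) (q j t)) ^ 2) ^ (-(3 / 2 : ℝ))) •
          (q j t - (σ * odot σ (q i t) (q j t)) • q i t))
      - (σ * odot σ (deriv (q i) t) (deriv (q i) t)) • q i t)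
    -- `μ₁` has a local minimum at `t₀`
    (t₀ : ℝ)
    (hmin : IsLocalMin (fun t =>
      (Finset.range n).inf' (Finset.nonempty_range_iff.mpr (by omega))
        (fun j => (if j + 1 = n then θ 0 t + 2 * π else θ (j + 1) t) - θ j t)) t₀) :
    -- conclusion: regular polygonal rotopulsator
    ∃ φ : ℝ → ℝ, ContDiff ℝ 2 φ ∧ ∀ i < n, ∀ t, θ i t = φ t + 2 * π * i / n := by
  have hσr : ∀ t, σ * r t ^ 2 ≤ 2 / 5 := fun t ↦ by
    rcases hcase with rfl | ⟨rfl, h⟩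
    · nlinarith [hr_pos t]
    · have h1 := pow_le_pow_left₀ (hr_pos t).le (h t).le 2
      rw [div_pow, Real.sq_sqrt (by norm_num)] at h1
      linarith
  have hn0 : 0 < n := by omega
  have hlift : ∀ k, liftAngle n θ k = fun t ↦ θ (k % n) t + (k / n : ℕ) * (2 * π) := fun _ ↦ rfl
  have hderiv : ∀ k, deriv (liftAngle n θ k) = deriv (θ (k % n)) := fun k ↦ by
    rw [hlift, deriv_add_const']
  have hsol : IsAngularSolution n σ m r (liftAngle n θ) :=
    { contDiff := fun k ↦ (hθ _ (Nat.mod_lt _ hn0)).add contDiff_const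
      lt_succ := fun k t ↦ by
        rw [← sub_pos, liftAngle_succ_sub hn]
        have hk := Nat.mod_lt k hn0
        split_ifs with h
        · linarith [hord2 t _ hk]
        · linarith [hord t (k % n) (k % n + 1) (by omega) (by omega)]
      add_period := liftAngle_add_period hn0 θ
      deriv_deriv := fun k t ↦ by
        rw [hderiv, sum_tangentialForce_liftAngle hn0]
        exact deriv_deriv_angle_eq hσ hr hr_pos hz hsphere hθ hq hODE (Nat.mod_lt _ hn0) t }
  refine ⟨θ 0, hθ 0 hn0, fun i hi t ↦ ?_⟩
  have hgaps : IsLocalMin (fun t ↦ (Finset.range n).inf'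
      (Finset.nonempty_range_iff.mpr (by omega))
      (fun j ↦ liftAngle n θ (j + 1) t - liftAngle n θ j t)) t₀ := by
    convert hmin using 1
    funext t
    refine Finset.inf'_congr _ rfl fun j hj ↦ ?_
    rw [liftAngle_succ_sub hn, Nat.mod_eq_of_lt (Finset.mem_range.1 hj)]
  have := hsol.eq_add_of_isLocalMin hn hm hr hr_pos hσr _ hgaps t hi
  rwa [liftAngle_of_lt θ hi, liftAngle_of_lt θ hn0] at this
end

section
/- Let n ≥ 2 and let q_1,…,q_n be a polygonal homographic orbit solution of the planar n-body system in which all masses are equal, i.e. m_1 = … = m_n = m for a single everywhere-positive function m : ℝ → ℝ. Then the configuration of the point masses is a regular polygon: α_{i+1} − α_i = 2π/n for all i ∈ {1,…,n−1} (equivalently α_i = α_1 + 2π(i−1)/n for all i). -/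
open Real

/-- An antisymmetric matrix whose row sums are all equal has zero row sums. -/
lemma row_sum_eq_zero_of_antisymm {n : ℕ} {D : ℕ → ℕ → ℝ} (hD : ∀ i j, D j i = -D i j) {c : ℝ}
    (hc : ∀ i < n, ∑ j ∈ Finset.range n, D i j = c) :
    ∀ i < n, ∑ j ∈ Finset.range n, D i j = 0 := by
  intro i hi
  have h1 : ∑ i ∈ Finset.range n, ∑ j ∈ Finset.range n, D i j = n * c := by
    rw [Finset.sum_congr rfl fun i hi => hc i (Finset.mem_range.1 hi)]
    simp
  have h2 : ∑ i ∈ Finset.range n, ∑ j ∈ Finset.range n, D i j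
      = -∑ i ∈ Finset.range n, ∑ j ∈ Finset.range n, D i j := by
    conv_lhs => rw [Finset.sum_comm]
    simp only [← Finset.sum_neg_distrib, ← hD]
  have hn : (n : ℝ) ≠ 0 := by
    have : n ≠ 0 := by omega
    exact_mod_cast this
  have h3 : (n : ℝ) * c = 0 := by linarith
  rw [hc i hi]
  exact (mul_eq_zero.1 h3).resolve_left hn

/-- For an odd periodic function, the net interaction at each of the equally spaced points of
the circle vanishes. -/
lemma sum_odd_periodic_equally_spaced {h : ℝ → ℝ} {T : ℝ} (hodd : Function.Odd h)
    (hper : Function.Periodic h T) (n : ℕ) :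
    ∀ i < n, ∑ j ∈ Finset.range n, h (T * j / n - T * i / n) = 0 := by
  have hstep : ∀ i : ℕ, i < n → ∑ j ∈ Finset.range n, h (T * j / n - T * i / n)
      = ∑ j ∈ Finset.range n, h (T * j / n) := by
    intro i
    induction i with
    | zero => simp
    | succ k ih =>
      intro hk
      rw [← ih (by omega)]
      obtain ⟨l, rfl⟩ : ∃ l, n = l + 1 := ⟨n - 1, by omega⟩
      rw [Finset.sum_range_succ', Finset.sum_range_succ]
      congr 1
      · refine Finset.sum_congr rfl fun j _ => ?_
        congr 1
        push_cast
        ring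
      · rw [← hper]
        congr 1
        push_cast
        field_simp
        ring
  exact row_sum_eq_zero_of_antisymm
    (fun i j => by rw [← hodd]; congr 1; ring) hstep

/-- Two angular configurations in equilibrium for an odd interaction that is strictly decreasing
on `(0, T)` have the same angular differences. -/
lemma sub_eq_sub_of_equilibrium {n : ℕ} {h : ℝ → ℝ} {T : ℝ} (hodd : Function.Odd h)
    (hanti : StrictAntiOn h (Set.Ioo 0 T)) {a b : ℕ → ℝ}
    (ha : ∀ i j, i < j → j < n → a j - a i ∈ Set.Ioo 0 T)
    (hb : ∀ i j, i < j → j < n → b j - b i ∈ Set.Ioo 0 T)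
    (ha0 : ∀ i < n, ∑ j ∈ Finset.range n, h (a j - a i) = 0)
    (hb0 : ∀ i < n, ∑ j ∈ Finset.range n, h (b j - b i) = 0)
    {i j : ℕ} (hij : i < j) (hj : j < n) : a j - a i = b j - b i := by
  set D : ℕ → ℕ → ℝ := fun i j => h (a j - a i) - h (b j - b i) with hD
  have hDanti : ∀ i j, D j i = -D i j := by
    intro i j
    simp only [hD]
    rw [← neg_sub (a j) (a i), ← neg_sub (b j) (b i), hodd, hodd]
    ring
  have hD0 : ∀ i < n, ∑ j ∈ Finset.range n, D i j = 0 := by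
    intro i hi
    simp only [hD, Finset.sum_sub_distrib, ha0 i hi, hb0 i hi, sub_zero]
  have hpos : ∀ i j, i < j → j < n → a j - a i ≠ b j - b i →
      0 < D i j * ((b j - a j) - (b i - a i)) := by
    intro i j hij hj hne
    rcases lt_or_gt_of_ne hne with hlt | hlt
    · have := hanti (ha i j hij hj) (hb i j hij hj) hlt
      exact mul_pos (by simp only [hD]; linarith) (by linarith)
    · have := hanti (hb i j hij hj) (ha i j hij hj) hlt
      exact mul_pos_of_neg_of_neg (by simp only [hD]; linarith) (by linarith)
  have hnonneg' : ∀ i j, i < j → j < n → 0 ≤ D i j * ((b j - a j) - (b i - a i)) := by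
    intro i j hij hj
    by_cases hne : a j - a i = b j - b i
    · have : (b j - a j) - (b i - a i) = 0 := by linarith
      rw [this, mul_zero]
    · exact (hpos i j hij hj hne).le
  have hnonneg : ∀ i ∈ Finset.range n, ∀ j ∈ Finset.range n,
      0 ≤ D i j * ((b j - a j) - (b i - a i)) := by
    intro i hi j hj
    rcases lt_trichotomy i j with hlt | rfl | hlt
    · exact hnonneg' i j hlt (Finset.mem_range.1 hj)
    · simp
    · have := hnonneg' j i hlt (Finset.mem_range.1 hi)
      rw [hDanti i j] at this
      linarith
  have hsum : ∑ i ∈ Finset.range n, ∑ j ∈ Finset.range n,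
      D i j * ((b j - a j) - (b i - a i)) = 0 := by
    simp only [mul_sub (D _ _) (b _ - a _), Finset.sum_sub_distrib]
    rw [Finset.sum_comm]
    have h1 : ∀ j ∈ Finset.range n, ∑ i ∈ Finset.range n, D i j * (b j - a j) = 0 := by
      intro j hj
      rw [← Finset.sum_mul, Finset.sum_congr rfl fun i _ => hDanti j i,
        Finset.sum_neg_distrib, hD0 j (Finset.mem_range.1 hj)]
      simp
    have h2 : ∀ i ∈ Finset.range n, ∑ j ∈ Finset.range n, D i j * (b i - a i) = 0 := by
      intro i hi
      rw [← Finset.sum_mul, hD0 i (Finset.mem_range.1 hi), zero_mul]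
    rw [Finset.sum_eq_zero h1, Finset.sum_eq_zero h2, sub_zero]
  by_contra hne
  have hi' : i ∈ Finset.range n := Finset.mem_range.2 (hij.trans hj)
  have hj' : j ∈ Finset.range n := Finset.mem_range.2 hj
  have hrow := (Finset.sum_eq_zero_iff_of_nonneg
    fun i hi => Finset.sum_nonneg (hnonneg i hi)).1 hsum i hi'
  have hterm := (Finset.sum_eq_zero_iff_of_nonneg (hnonneg i hi')).1 hrow j hj'
  exact (hpos i j hij hj hne).ne' hterm

/-- The tangential force between two points of a circle of radius `R`, as a function of their
angular difference, is strictly decreasing on `(0, 2π)`. -/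
lemma strictAntiOn_tangential_force {f : ℝ → ℝ} (hf_pos : ∀ x > 0, 0 < f x)
    (hf_dec : AntitoneOn (fun x => √x * f x) (Set.Ioi 0)) {R : ℝ} (hR : 0 < R) :
    StrictAntiOn (fun θ => sin θ * f (2 * R ^ 2 * (1 - cos θ))) (Set.Ioo 0 (2 * π)) := by
  set G : ℝ → ℝ := fun x => √x * f x with hG
  have hGpos : ∀ x > 0, 0 < G x := fun x hx => mul_pos (Real.sqrt_pos.2 hx) (hf_pos x hx)
  have hsin : ∀ θ ∈ Set.Ioo 0 (2 * π), 0 < sin (θ / 2) := fun θ hθ =>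
    sin_pos_of_pos_of_lt_pi (by linarith [hθ.1]) (by linarith [hθ.2])
  have hcos : ∀ θ : ℝ, 1 - cos θ = 2 * sin (θ / 2) ^ 2 := by
    intro θ
    have h1 := cos_sq' (θ / 2)
    have h2 := cos_two_mul (θ / 2)
    rw [mul_div_cancel₀ θ two_ne_zero] at h2
    linarith
  have hkey : ∀ θ ∈ Set.Ioo 0 (2 * π), sin θ * f (2 * R ^ 2 * (1 - cos θ))
      = R⁻¹ * (cos (θ / 2) * G (2 * R ^ 2 * (1 - cos θ))) := by
    intro θ hθ
    have hs := hsin θ hθ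
    have h1 : √(2 * R ^ 2 * (1 - cos θ)) = 2 * R * sin (θ / 2) := by
      rw [hcos, show 2 * R ^ 2 * (2 * sin (θ / 2) ^ 2) = (2 * R * sin (θ / 2)) ^ 2 by ring]
      exact Real.sqrt_sq (by positivity)
    have h2 := sin_two_mul (θ / 2)
    rw [mul_div_cancel₀ θ two_ne_zero] at h2
    simp only [hG]
    rw [h1, h2]
    field_simp
  intro x hx y hy hxy
  simp only
  rw [hkey x hx, hkey y hy]
  refine mul_lt_mul_of_pos_left ?_ (inv_pos.2 hR)
  have hsqpos : ∀ θ ∈ Set.Ioo 0 (2 * π), 0 < 2 * R ^ 2 * (1 - cos θ) := by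
    intro θ hθ
    have := hsin θ hθ
    rw [hcos]
    positivity
  have hX := hsqpos x hx
  have hY := hsqpos y hy
  have huv : cos (y / 2) < cos (x / 2) :=
    cos_lt_cos_of_nonneg_of_le_pi (by linarith [hx.1]) (by linarith [hy.2]) (by linarith)
  have hcomp : ∀ θ : ℝ, 2 * R ^ 2 * (1 - cos θ) = 4 * R ^ 2 * (1 - cos (θ / 2) ^ 2) := by
    intro θ
    rw [hcos, sin_sq]
    ring
  rcases le_or_gt 0 (cos (y / 2)) with hv | hv
  · have hle : G (2 * R ^ 2 * (1 - cos y)) ≤ G (2 * R ^ 2 * (1 - cos x)) := by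
      refine hf_dec hX hY ?_
      rw [hcomp, hcomp]
      gcongr
    calc _ ≤ cos (y / 2) * G (2 * R ^ 2 * (1 - cos x)) := by gcongr
      _ < _ := mul_lt_mul_of_pos_right huv (hGpos _ hX)
  · rcases le_or_gt (cos (x / 2)) 0 with hu | hu
    · have hle : G (2 * R ^ 2 * (1 - cos x)) ≤ G (2 * R ^ 2 * (1 - cos y)) := by
        refine hf_dec hY hX ?_
        rw [hcomp, hcomp]
        refine mul_le_mul_of_nonneg_left ?_ (by positivity)
        nlinarith
      calc _ < cos (x / 2) * G (2 * R ^ 2 * (1 - cos y)) :=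
            mul_lt_mul_of_pos_right huv (hGpos _ hY)
        _ ≤ _ := mul_le_mul_of_nonpos_left hle hu
    · have h1 := mul_pos hu (hGpos _ hX)
      have h2 := mul_neg_of_neg_of_pos hv (hGpos _ hY)
      linarith

/-- The second derivative of a curve given in polar coordinates. -/
lemma deriv_deriv_polar {r φ : ℝ → ℝ} (hr : ContDiff ℝ 2 r) (hφ : ContDiff ℝ 2 φ) (a t : ℝ) :
    deriv (deriv fun t => (r t * cos (φ t + a), r t * sin (φ t + a))) t =
      ((deriv (deriv r) t - r t * deriv φ t ^ 2) * cos (φ t + a)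
          - (2 * deriv r t * deriv φ t + r t * deriv (deriv φ) t) * sin (φ t + a),
        (deriv (deriv r) t - r t * deriv φ t ^ 2) * sin (φ t + a)
          + (2 * deriv r t * deriv φ t + r t * deriv (deriv φ) t) * cos (φ t + a)) := by
  have hd : ∀ {g : ℝ → ℝ}, ContDiff ℝ 2 g → ∀ s, HasDerivAt g (deriv g s) s :=
    fun hg s => (hg.differentiable (by norm_num) s).hasDerivAt
  have hdd : ∀ {g : ℝ → ℝ}, ContDiff ℝ 2 g → ∀ s, HasDerivAt (deriv g) (deriv (deriv g) s) s :=
    fun hg s => ((hg.deriv' (n := 1)).differentiable (by norm_num) s).hasDerivAt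
  have h1 : deriv (fun t => (r t * cos (φ t + a), r t * sin (φ t + a))) = fun s =>
      (deriv r s * cos (φ s + a) + r s * (-sin (φ s + a) * deriv φ s),
        deriv r s * sin (φ s + a) + r s * (cos (φ s + a) * deriv φ s)) := by
    funext s
    have hψ := (hd hφ s).add_const a
    exact (((hd hr s).mul hψ.cos).prodMk ((hd hr s).mul hψ.sin)).deriv
  rw [h1]
  have hψ := (hd hφ t).add_const a
  have hx := ((hdd hr t).mul hψ.cos).add ((hd hr t).mul (hψ.sin.neg.mul (hdd hφ t)))
  have hy := ((hdd hr t).mul hψ.sin).add ((hd hr t).mul (hψ.cos.mul (hdd hφ t)))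
  refine (hx.prodMk hy).deriv.trans ?_
  ext <;> simp <;> ring

/-- A polygonal homographic orbit solution of the planar `n`-body problem
with all masses equal (to a single everywhere-positive function `m`) has a regular
polygon configuration: consecutive angular differences all equal `2π/n`.
Bodies are indexed by `i ∈ {0, …, n-1}`. -/
theorem homographic_equal_masses_regular_polygon
    (n : ℕ) (hn : 2 ≤ n)
    -- the kernel `f`: positive on `(0,∞)`, with `x ↦ √x · f x` decreasing on `(0,∞)`
    (f : ℝ → ℝ) (hf_pos : ∀ x > 0, 0 < f x)
    (hf_dec : AntitoneOn (fun x => Real.sqrt x * f x) (Set.Ioi 0))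
    -- the common mass function, everywhere positive
    (m : ℝ → ℝ) (hm : ∀ t, 0 < m t)
    -- the radius, twice continuously differentiable and positive
    (r : ℝ → ℝ) (hr : ContDiff ℝ 2 r) (hr_pos : ∀ t, 0 < r t)
    -- the common rotation angle, twice continuously differentiable
    (φ : ℝ → ℝ) (hφ : ContDiff ℝ 2 φ)
    -- the constant phases, with `0 ≤ α₀ < α₁ < … < α_{n-1} < 2π`
    (α : ℕ → ℝ) (hα0 : 0 ≤ α 0)
    (hord : ∀ i j, i < j → j < n → α i < α j)
    (hα2π : ∀ i < n, α i < 2 * π)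
    -- the bodies
    (q : ℕ → ℝ → ℝ × ℝ)
    (hq : ∀ i < n, ∀ t,
      q i t = (r t * Real.cos (φ t + α i), r t * Real.sin (φ t + α i)))
    -- the equations of motion
    (hODE : ∀ i < n, ∀ t, deriv (deriv (q i)) t =
      ∑ j ∈ (Finset.range n).erase i,
        (m t * f (((q j t).1 - (q i t).1) ^ 2 + ((q j t).2 - (q i t).2) ^ 2)) •
          (q j t - q i t)) :
    -- conclusion: the configuration is a regular polygon
    ∀ i, i + 1 < n → α (i + 1) - α i = 2 * π / n := by
  set h : ℝ → ℝ := fun θ => sin θ * f (2 * r 0 ^ 2 * (1 - cos θ)) with hh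
  have hodd : Function.Odd h := fun θ => by simp [hh]
  have hper : Function.Periodic h (2 * π) := fun θ => by simp [hh]
  have htangential : ∀ i < n, ∑ j ∈ Finset.range n, h (α j - α i) =
      (2 * deriv r 0 * deriv φ 0 + r 0 * deriv (deriv φ) 0) / (m 0 * r 0) := by
    intro i hi
    have hqi : q i = fun t => (r t * cos (φ t + α i), r t * sin (φ t + α i)) :=
      funext (hq i hi)
    have hode := hODE i hi 0
    rw [Finset.sum_erase _ (by simp)] at hode
    conv_lhs at hode => rw [hqi, deriv_deriv_polar hr hφ]
    have hfst := congrArg Prod.fst hode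
    have hsnd := congrArg Prod.snd hode
    rw [Prod.fst_sum] at hfst
    rw [Prod.snd_sum] at hsnd
    simp only at hfst hsnd
    rw [eq_div_iff (mul_pos (hm 0) (hr_pos 0)).ne', Finset.sum_mul]
    have hcs := sin_sq_add_cos_sq (φ 0 + α i)
    have hproj := congrArg₂ (fun x y => -sin (φ 0 + α i) * x + cos (φ 0 + α i) * y) hfst hsnd
    symm
    refine Eq.trans ?_ (hproj.trans ?_)
    · linear_combination (-(2 * deriv r 0 * deriv φ 0 + r 0 * deriv (deriv φ) 0)) * hcs
    rw [Finset.mul_sum, Finset.mul_sum, ← Finset.sum_add_distrib]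
    refine Finset.sum_congr rfl fun j hj => ?_
    rw [hq i hi, hq j (Finset.mem_range.1 hj)]
    have hdiff : α j - α i = (φ 0 + α j) - (φ 0 + α i) := by ring
    have hdist : (r 0 * cos (φ 0 + α j) - r 0 * cos (φ 0 + α i)) ^ 2
        + (r 0 * sin (φ 0 + α j) - r 0 * sin (φ 0 + α i)) ^ 2
        = 2 * r 0 ^ 2 * (1 - cos (α j - α i)) := by
      rw [hdiff, cos_sub]
      linear_combination r 0 ^ 2 * hcs + r 0 ^ 2 * sin_sq_add_cos_sq (φ 0 + α j)
    simp only [Prod.smul_fst, Prod.smul_snd, Prod.fst_sub, Prod.snd_sub, smul_eq_mul, hdist, hh]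
    have hsin : sin (α j - α i) = sin (φ 0 + α j) * cos (φ 0 + α i)
        - cos (φ 0 + α j) * sin (φ 0 + α i) := by rw [hdiff, sin_sub]
    rw [hsin]
    ring
  have hequilibrium : ∀ i < n, ∑ j ∈ Finset.range n, h (α j - α i) = 0 :=
    row_sum_eq_zero_of_antisymm (fun i j => by rw [← hodd, neg_sub]) htangential
  have hα_nonneg : ∀ i < n, 0 ≤ α i := by
    intro i hi
    rcases Nat.eq_zero_or_pos i with rfl | hpos
    · exact hα0
    · exact hα0.trans (hord 0 i hpos hi).le
  have hn0 : (0 : ℝ) < n := by exact_mod_cast (by omega : 0 < n)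
  intro i hi
  have hrigid := sub_eq_sub_of_equilibrium (b := fun j => 2 * π * j / n) hodd
    (strictAntiOn_tangential_force hf_pos hf_dec (hr_pos 0))
    (fun i j hij hj => ⟨sub_pos.2 (hord i j hij hj),
      by linarith [hα2π j hj, hα_nonneg i (hij.trans hj)]⟩)
    (fun i j hij hj => by
      have hij' : (i : ℝ) < j := by exact_mod_cast hij
      have hj' : (j : ℝ) < n := by exact_mod_cast hj
      have hi0 : (0 : ℝ) ≤ i := i.cast_nonneg
      rw [← sub_div, ← mul_sub]
      constructor
      · have := sub_pos.2 hij'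
        positivity
      · rw [div_lt_iff₀ hn0]
        exact mul_lt_mul_of_pos_left (by linarith) two_pi_pos)
    hequilibrium (sum_odd_periodic_equally_spaced hodd hper n) (Nat.lt_succ_self i) hi
  rw [hrigid]
  push_cast
  ring
end

section
/- Let n ≥ 3 and let q_1,…,q_n be a polygonal homographic orbit solution of the centered type of the planar n-body system, in which the masses of the n−1 bodies on the circle are all equal, m_1 = … = m_{n−1} = m, with m : ℝ → ℝ everywhere positive and the central mass m_n = M everywhere positive. Then the configuration of the n−1 bodies on the circle is a regular polygon: α_{i+1} − α_i = 2π/(n−1) for all i ∈ {1,…,n−2}. -/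
open Real

/-- An odd function which is strictly decreasing on `(0, 2π)` admits, up to rotation, at most one
ordered configuration of angles at which all its row sums vanish. -/
lemma sub_eq_sub_of_sum_eq_zero {N : ℕ} {F : ℝ → ℝ} (hodd : ∀ x, F (-x) = -F x)
    (hF : StrictAntiOn F (Set.Ioo 0 (2 * π))) {α β : ℕ → ℝ}
    (hα : ∀ i j, i < j → j < N → α j - α i ∈ Set.Ioo 0 (2 * π))
    (hβ : ∀ i j, i < j → j < N → β j - β i ∈ Set.Ioo 0 (2 * π))
    (hα_sum : ∀ i < N, ∑ j ∈ Finset.range N, F (α j - α i) = 0)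
    (hβ_sum : ∀ i < N, ∑ j ∈ Finset.range N, F (β j - β i) = 0)
    {i j : ℕ} (hij : i < j) (hj : j < N) : α j - α i = β j - β i := by
  have key : ∀ x ∈ Set.Ioo 0 (2 * π), ∀ y ∈ Set.Ioo 0 (2 * π), x ≠ y →
      (x - y) * (F x - F y) < 0 := by
    intro x hx y hy hxy
    rcases lt_or_gt_of_ne hxy with h | h
    · have := hF hx hy h
      exact mul_neg_of_neg_of_pos (by linarith) (by linarith)
    · have := hF hy hx h
      exact mul_neg_of_pos_of_neg (by linarith) (by linarith)
  set T : ℕ → ℕ → ℝ := fun i j =>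
    ((α j - α i) - (β j - β i)) * (F (α j - α i) - F (β j - β i)) with hT
  have T_symm : ∀ i j, T i j = T j i := by
    intro i j
    have h1 := hodd (α j - α i)
    have h2 := hodd (β j - β i)
    rw [neg_sub] at h1 h2
    simp only [hT, h1, h2]
    ring
  have T_lt : ∀ i j, i < j → j < N → T i j ≤ 0 := by
    intro i j hij hj
    by_cases h : α j - α i = β j - β i
    · simp [hT, h]
    · exact (key _ (hα i j hij hj) _ (hβ i j hij hj) h).le
  have T_nonpos : ∀ i ∈ Finset.range N, ∀ j ∈ Finset.range N, T i j ≤ 0 := by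
    intro i hi j hj
    rw [Finset.mem_range] at hi hj
    rcases lt_trichotomy i j with h | h | h
    · exact T_lt i j h hj
    · simp [hT, h]
    · exact T_symm i j ▸ T_lt j i h hi
  have row : ∀ i ∈ Finset.range N,
      ∑ j ∈ Finset.range N, (F (α j - α i) - F (β j - β i)) = 0 := by
    intro i hi
    rw [Finset.mem_range] at hi
    rw [Finset.sum_sub_distrib, hα_sum i hi, hβ_sum i hi, sub_zero]
  have col : ∀ j ∈ Finset.range N,
      ∑ i ∈ Finset.range N, (F (α j - α i) - F (β j - β i)) = 0 := by
    intro j hj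
    rw [← neg_eq_zero, ← Finset.sum_neg_distrib, ← row j hj]
    refine Finset.sum_congr rfl fun i _ => ?_
    rw [← neg_sub (α j), ← neg_sub (β j), hodd, hodd]
    ring
  have total : ∑ i ∈ Finset.range N, ∑ j ∈ Finset.range N, T i j = 0 := by
    have split : ∀ i j, T i j = (α j - β j) * (F (α j - α i) - F (β j - β i)) -
        (α i - β i) * (F (α j - α i) - F (β j - β i)) := by
      intro i j
      simp only [hT]
      ring
    simp only [split, Finset.sum_sub_distrib (s := Finset.range N)
      (f := fun j => (α j - β j) * _)]
    rw [Finset.sum_sub_distrib, Finset.sum_comm]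
    simp only [← Finset.mul_sum]
    rw [Finset.sum_eq_zero fun j hj => by rw [col j hj, mul_zero],
      Finset.sum_eq_zero fun i hi => by rw [row i hi, mul_zero], sub_zero]
  have hi : i ∈ Finset.range N := Finset.mem_range.2 (hij.trans hj)
  have hj' : j ∈ Finset.range N := Finset.mem_range.2 hj
  have row_zero := (Finset.sum_eq_zero_iff_of_nonpos
    fun i hi => Finset.sum_nonpos (T_nonpos i hi)).1 total i hi
  have T_zero := (Finset.sum_eq_zero_iff_of_nonpos (T_nonpos i hi)).1 row_zero j hj'
  by_contra h
  exact (key _ (hα i j hij hj) _ (hβ i j hij hj) h).ne T_zero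

/-- If the row sums of an odd function of the differences all agree, they vanish. -/
lemma sum_sub_eq_zero_of_forall_eq {N : ℕ} {F : ℝ → ℝ} (hodd : ∀ x, F (-x) = -F x)
    {α : ℕ → ℝ} {c : ℝ} (h : ∀ i < N, ∑ j ∈ Finset.range N, F (α j - α i) = c) :
    ∀ i < N, ∑ j ∈ Finset.range N, F (α j - α i) = 0 := by
  intro i hi
  have h1 : ∑ i ∈ Finset.range N, ∑ j ∈ Finset.range N, F (α j - α i) = N * c := by
    rw [Finset.sum_congr rfl fun i hi => h i (Finset.mem_range.1 hi)]
    simp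
  have h2 : ∑ i ∈ Finset.range N, ∑ j ∈ Finset.range N, F (α j - α i) =
      -∑ i ∈ Finset.range N, ∑ j ∈ Finset.range N, F (α j - α i) := by
    conv_lhs => rw [Finset.sum_comm]
    simp only [← Finset.sum_neg_distrib, ← hodd, neg_sub]
  have h3 : (N : ℝ) * c = 0 := by linarith
  have hN : (N : ℝ) ≠ 0 := by exact_mod_cast (by omega : N ≠ 0)
  rw [h i hi]
  exact (mul_eq_zero.1 h3).resolve_left hN

/-- The row sums of an odd `2π`-periodic function vanish on the regular polygon. -/
lemma sum_regular_polygon_eq_zero {N : ℕ} {F : ℝ → ℝ} (hodd : ∀ x, F (-x) = -F x)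
    (hper : Function.Periodic F (2 * π)) :
    ∀ i < N, ∑ j ∈ Finset.range N, F (2 * π / N * j - 2 * π / N * i) = 0 := by
  refine sum_sub_eq_zero_of_forall_eq (α := fun i => 2 * π / N * i) hodd
    (c := ∑ j ∈ Finset.range N, F (2 * π / N * j)) fun i hi => ?_
  have hN : (N : ℝ) ≠ 0 := by exact_mod_cast (by omega : N ≠ 0)
  clear hi
  induction i with
  | zero => simp
  | succ k ih =>
    rw [← ih]
    have e := (Finset.sum_range_succ
      (fun j : ℕ => F (2 * π / N * j - 2 * π / N * (k + 1 : ℕ))) N).symm.trans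
      (Finset.sum_range_succ' _ N)
    have h1 : F (2 * π / N * N - 2 * π / N * (k + 1 : ℕ)) =
        F (2 * π / N * (0 : ℕ) - 2 * π / N * (k + 1 : ℕ)) := by
      rw [← hper (2 * π / N * (0 : ℕ) - _)]
      congr 1
      field_simp
      push_cast
      ring
    rw [h1] at e
    rw [add_right_cancel e]
    refine Finset.sum_congr rfl fun j _ => ?_
    congr 1
    push_cast
    ring

/-- The tangential force between two bodies on a circle of radius `ρ` is a strictly decreasing
function of their angular distance. -/
lemma strictAntiOn_sin_mul_kernel {f : ℝ → ℝ} (hf_pos : ∀ x > 0, 0 < f x)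
    (hf_dec : AntitoneOn (fun x => √x * f x) (Set.Ioi 0)) {ρ : ℝ} (hρ : 0 < ρ) :
    StrictAntiOn (fun d => sin d * f (ρ ^ 2 * (2 - 2 * cos d))) (Set.Ioo 0 (2 * π)) := by
  set s : ℝ → ℝ := fun d => 2 * ρ * sin (d / 2) with hs
  set g : ℝ → ℝ := fun x => x * f (x ^ 2) with hg
  have g_anti : ∀ x y, 0 < x → x ≤ y → g y ≤ g x := by
    intro x y hx hxy
    have := hf_dec (Set.mem_Ioi.2 (pow_pos hx 2)) (Set.mem_Ioi.2 (pow_pos (hx.trans_le hxy) 2))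
      (pow_le_pow_left₀ hx.le hxy 2)
    simpa only [sqrt_sq hx.le, sqrt_sq (hx.le.trans hxy)] using this
  have g_pos : ∀ x, 0 < x → 0 < g x := fun x hx => mul_pos hx (hf_pos _ (pow_pos hx 2))
  have s_pos : ∀ d ∈ Set.Ioo 0 (2 * π), 0 < s d := fun d hd =>
    mul_pos (by linarith) (sin_pos_of_pos_of_lt_pi (by linarith [hd.1]) (by linarith [hd.2]))
  have eq : ∀ d, ρ * (sin d * f (ρ ^ 2 * (2 - 2 * cos d))) = cos (d / 2) * g (s d) := by
    intro d
    have h1 : sin d = 2 * sin (d / 2) * cos (d / 2) := by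
      rw [← sin_two_mul]; ring_nf
    have h2 : ρ ^ 2 * (2 - 2 * cos d) = s d ^ 2 := by
      have : cos d = 1 - 2 * sin (d / 2) ^ 2 := by
        rw [show d = 2 * (d / 2) by ring, cos_two_mul, cos_sq']; ring_nf
      rw [this, hs]; ring
    rw [h2, h1, hg, hs]; ring
  intro x hx y hy hxy
  refine lt_of_mul_lt_mul_left (a := ρ) ?_ hρ.le
  change ρ * (sin y * f _) < ρ * (sin x * f _)
  rw [eq, eq]
  have hcos : cos (y / 2) < cos (x / 2) :=
    cos_lt_cos_of_nonneg_of_le_pi (by linarith [hx.1]) (by linarith [hy.2]) (by linarith)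
  have hgx := g_pos _ (s_pos x hx)
  have hgy := g_pos _ (s_pos y hy)
  rcases le_total y π with h | h
  · have hsxy : s x ≤ s y := mul_le_mul_of_nonneg_left
      (sin_le_sin_of_le_of_le_pi_div_two (by linarith [hx.1]) (by linarith) (by linarith))
      (by linarith)
    have hcy : 0 ≤ cos (y / 2) :=
      cos_nonneg_of_neg_pi_div_two_le_of_le (by linarith [hy.1, pi_pos]) (by linarith)
    calc cos (y / 2) * g (s y) ≤ cos (y / 2) * g (s x) :=
          mul_le_mul_of_nonneg_left (g_anti _ _ (s_pos x hx) hsxy) hcy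
      _ < cos (x / 2) * g (s x) := mul_lt_mul_of_pos_right hcos hgx
  · have hcy : cos (y / 2) ≤ 0 :=
      cos_nonpos_of_pi_div_two_le_of_le (by linarith) (by linarith [hy.2, pi_pos])
    rcases le_total x π with h' | h'
    · have hcx : 0 ≤ cos (x / 2) :=
        cos_nonneg_of_neg_pi_div_two_le_of_le (by linarith [hx.1, pi_pos]) (by linarith)
      nlinarith [mul_nonneg hcx hgx.le, mul_nonneg (neg_nonneg.2 hcy) hgy.le,
        mul_pos (sub_pos.2 hcos) hgx, mul_pos (sub_pos.2 hcos) hgy]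
    · have hsxy : s y ≤ s x := by
        refine mul_le_mul_of_nonneg_left ?_ (by linarith)
        rw [← sin_pi_sub (x / 2), ← sin_pi_sub (y / 2)]
        exact sin_le_sin_of_le_of_le_pi_div_two (by linarith [hy.2]) (by linarith) (by linarith)
      calc cos (y / 2) * g (s y) ≤ cos (y / 2) * g (s x) :=
            mul_le_mul_of_nonpos_left (g_anti _ _ (s_pos y hy) hsxy) hcy
        _ < cos (x / 2) * g (s x) := mul_lt_mul_of_pos_right hcos hgx

/-- The tangential acceleration in polar coordinates. -/
lemma tangential_deriv_deriv_polar {r φ : ℝ → ℝ} (hr : ContDiff ℝ 2 r) (hφ : ContDiff ℝ 2 φ)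
    (a t : ℝ) {q : ℝ → ℝ × ℝ} (hq : ∀ t, q t = (r t * cos (φ t + a), r t * sin (φ t + a))) :
    cos (φ t + a) * (deriv (deriv q) t).2 - sin (φ t + a) * (deriv (deriv q) t).1 =
      2 * deriv r t * deriv φ t + r t * deriv (deriv φ) t := by
  have hr1 : ∀ t, HasDerivAt r (deriv r t) t := fun t =>
    (hr.differentiable (by norm_num) t).hasDerivAt
  have hφ1 : ∀ t, HasDerivAt φ (deriv φ t) t := fun t =>
    (hφ.differentiable (by norm_num) t).hasDerivAt
  have hr2 : HasDerivAt (deriv r) (deriv (deriv r) t) t :=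
    (hr.differentiable_deriv_two t).hasDerivAt
  have hφ2 : HasDerivAt (deriv φ) (deriv (deriv φ) t) t :=
    (hφ.differentiable_deriv_two t).hasDerivAt
  have hc : ∀ t, HasDerivAt (fun t => cos (φ t + a)) (-sin (φ t + a) * deriv φ t) t :=
    fun t => ((hφ1 t).add_const a).cos
  have hs : ∀ t, HasDerivAt (fun t => sin (φ t + a)) (cos (φ t + a) * deriv φ t) t :=
    fun t => ((hφ1 t).add_const a).sin
  have hq1 : deriv q = fun t =>
      (deriv r t * cos (φ t + a) + r t * (-sin (φ t + a) * deriv φ t),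
        deriv r t * sin (φ t + a) + r t * (cos (φ t + a) * deriv φ t)) := by
    rw [funext hq]
    exact funext fun t => (((hr1 t).mul (hc t)).prodMk ((hr1 t).mul (hs t))).deriv
  have hq2 : deriv (deriv q) t =
      (deriv (deriv r) t * cos (φ t + a) + deriv r t * (-sin (φ t + a) * deriv φ t) +
        (deriv r t * (-sin (φ t + a) * deriv φ t) +
          r t * (-(cos (φ t + a) * deriv φ t) * deriv φ t +
            -sin (φ t + a) * deriv (deriv φ) t)),
      deriv (deriv r) t * sin (φ t + a) + deriv r t * (cos (φ t + a) * deriv φ t) +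
        (deriv r t * (cos (φ t + a) * deriv φ t) +
          r t * (-sin (φ t + a) * deriv φ t * deriv φ t +
            cos (φ t + a) * deriv (deriv φ) t))) := by
    rw [hq1]
    exact (((hr2.mul (hc t)).add ((hr1 t).mul ((hs t).neg.mul hφ2))).prodMk
      ((hr2.mul (hs t)).add ((hr1 t).mul ((hc t).mul hφ2)))).deriv
  rw [hq2]
  linear_combination (2 * deriv r t * deriv φ t + r t * deriv (deriv φ) t) *
    sin_sq_add_cos_sq (φ t + a)

/-- A polygonal homographic orbit solution of centered type of the planar
`n`-body problem (`n-1` bodies on a circle, one body at the origin), with the `n-1`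
circling masses all equal to a single everywhere-positive function `m` and an
everywhere-positive central mass `M`, has its circling bodies in a regular polygon
configuration: consecutive angular differences all equal `2π/(n-1)`.
Bodies on the circle are indexed by `i ∈ {0, …, n-2}`; the central body is body `n-1`. -/
theorem centered_homographic_equal_masses_regular_polygon
    (n : ℕ) (hn : 3 ≤ n)
    -- the kernel `f`: positive on `(0,∞)`, with `x ↦ √x · f x` decreasing on `(0,∞)`
    (f : ℝ → ℝ) (hf_pos : ∀ x > 0, 0 < f x)
    (hf_dec : AntitoneOn (fun x => Real.sqrt x * f x) (Set.Ioi 0))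
    -- the common mass function of the circling bodies and the central mass
    (m M : ℝ → ℝ) (hm : ∀ t, 0 < m t) (hM : ∀ t, 0 < M t)
    -- masses in order: bodies `0,…,n-2` have mass `m`, body `n-1` has mass `M`
    (mass : ℕ → ℝ → ℝ) (hmass : ∀ i < n - 1, mass i = m) (hmassn : mass (n - 1) = M)
    -- the radius, twice continuously differentiable and positive
    (r : ℝ → ℝ) (hr : ContDiff ℝ 2 r) (hr_pos : ∀ t, 0 < r t)
    -- the common rotation angle, twice continuously differentiable
    (φ : ℝ → ℝ) (hφ : ContDiff ℝ 2 φ)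
    -- the constant phases, with `0 ≤ α₀ < α₁ < … < α_{n-2} < 2π`
    (α : ℕ → ℝ) (hα0 : 0 ≤ α 0)
    (hord : ∀ i j, i < j → j < n - 1 → α i < α j)
    (hα2π : ∀ i < n - 1, α i < 2 * π)
    -- the bodies
    (q : ℕ → ℝ → ℝ × ℝ)
    (hq : ∀ i < n - 1, ∀ t,
      q i t = (r t * Real.cos (φ t + α i), r t * Real.sin (φ t + α i)))
    (hqn : ∀ t, q (n - 1) t = (0, 0))
    -- the equations of motion
    (hODE : ∀ i < n, ∀ t, deriv (deriv (q i)) t =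
      ∑ j ∈ (Finset.range n).erase i,
        (mass j t * f (((q j t).1 - (q i t).1) ^ 2 + ((q j t).2 - (q i t).2) ^ 2)) •
          (q j t - q i t)) :
    -- conclusion: the circling bodies form a regular polygon
    ∀ i, i + 1 < n - 1 → α (i + 1) - α i = 2 * π / (n - 1) := by
  obtain ⟨N, rfl⟩ : ∃ N, n = N + 1 := ⟨n - 1, by omega⟩
  rw [Nat.add_sub_cancel] at hmass hmassn hord hα2π hq hqn
  rw [Nat.add_sub_cancel, Nat.cast_add, Nat.cast_one, add_sub_cancel_right]
  have hN : (0 : ℝ) < N := by exact_mod_cast (by omega : 0 < N)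
  set F : ℝ → ℝ := fun d => sin d * f (r 0 ^ 2 * (2 - 2 * cos d)) with hF
  have hodd : ∀ x, F (-x) = -F x := fun x => by simp [hF]
  have hper : Function.Periodic F (2 * π) := fun x => by simp [hF]
  have hα : ∀ i j, i < j → j < N → α j - α i ∈ Set.Ioo 0 (2 * π) := by
    intro i j hij hj
    have h0 : 0 ≤ α i := by
      rcases Nat.eq_zero_or_pos i with rfl | h
      · exact hα0
      · exact hα0.trans (hord 0 i h (hij.trans hj)).le
    exact ⟨sub_pos.2 (hord i j hij hj), by linarith [hα2π j hj]⟩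
  have hβ : ∀ i j : ℕ, i < j → j < N →
      2 * π / N * j - 2 * π / N * i ∈ Set.Ioo 0 (2 * π) := by
    intro i j hij hj
    have hij' : (i : ℝ) < j := by exact_mod_cast hij
    have hj' : (j : ℝ) < N := by exact_mod_cast hj
    have hi' : (0 : ℝ) ≤ i := i.cast_nonneg
    have hpos : 0 < 2 * π / N := by positivity
    have hmul : 2 * π / N * N = 2 * π := by field_simp
    constructor <;> nlinarith
  have hα_sum : ∀ i < N, ∑ j ∈ Finset.range N, F (α j - α i) =
      (2 * deriv r 0 * deriv φ 0 + r 0 * deriv (deriv φ) 0) / (m 0 * r 0) := by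
    intro i hi
    have hmr : m 0 * r 0 ≠ 0 := (mul_pos (hm 0) (hr_pos 0)).ne'
    rw [eq_div_iff hmr, ← tangential_deriv_deriv_polar hr hφ (α i) 0 (hq i hi),
      hODE i (by omega) 0, Prod.snd_sum, Prod.fst_sum, Finset.mul_sum, Finset.mul_sum,
      ← Finset.sum_sub_distrib, Finset.sum_erase _ (by simp), Finset.sum_range_succ, hqn,
      hq i hi, Finset.sum_mul]
    have central : ∀ k : ℝ, cos (φ 0 + α i) * (k • ((0, 0) -
          (r 0 * cos (φ 0 + α i), r 0 * sin (φ 0 + α i)))).2 -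
        sin (φ 0 + α i) * (k • ((0, 0) -
          (r 0 * cos (φ 0 + α i), r 0 * sin (φ 0 + α i)))).1 = 0 := by
      intro k
      simp only [Prod.smul_snd, Prod.smul_fst, Prod.snd_sub, Prod.fst_sub, smul_eq_mul]
      ring
    rw [central, add_zero]
    refine Finset.sum_congr rfl fun j hj => ?_
    rw [Finset.mem_range] at hj
    have hsub : α j - α i = (φ 0 + α j) - (φ 0 + α i) := by ring
    have hdist : (r 0 * cos (φ 0 + α j) - r 0 * cos (φ 0 + α i)) ^ 2 +
        (r 0 * sin (φ 0 + α j) - r 0 * sin (φ 0 + α i)) ^ 2 =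
        r 0 ^ 2 * (2 - 2 * cos (α j - α i)) := by
      rw [hsub, cos_sub]
      linear_combination r 0 ^ 2 * sin_sq_add_cos_sq (φ 0 + α j) +
        r 0 ^ 2 * sin_sq_add_cos_sq (φ 0 + α i)
    rw [hq j hj, hmass j hj]
    simp only [Prod.smul_snd, Prod.smul_fst, Prod.snd_sub, Prod.fst_sub, smul_eq_mul]
    rw [hdist]
    have hsin : sin (α j - α i) = sin (φ 0 + α j) * cos (φ 0 + α i) -
        cos (φ 0 + α j) * sin (φ 0 + α i) := by
      rw [hsub, sin_sub]
    simp only [hF]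
    rw [hsin]
    ring
  intro i hi
  rw [sub_eq_sub_of_sum_eq_zero (β := fun i => 2 * π / N * i) hodd
    (strictAntiOn_sin_mul_kernel hf_pos hf_dec (hr_pos 0)) hα hβ
    (sum_sub_eq_zero_of_forall_eq hodd hα_sum) (sum_regular_polygon_eq_zero hodd hper)
    i.lt_succ_self hi]
  push_cast
  ring
end

section
/- Let f : (0,∞) → (0,∞) be such that x ↦ √x·f(x) is decreasing on (0,∞), and let r > 0. Then the function g(x) := sin(x)·f(2r²(1 − cos x)) is decreasing (antitone) on the open interval (0, 2π). -/
open Real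

/-- The half-angle form of `sin x * f (2r²(1 - cos x))`. -/
lemma sin_mul_comp_eq_cos_half_mul (f : ℝ → ℝ) {r x : ℝ} (hr : 0 < r)
    (hx : x ∈ Set.Ioo 0 (2 * π)) :
    sin x * f (2 * r ^ 2 * (1 - cos x)) =
      cos (x / 2) * (√(2 * r ^ 2 * (1 - cos x)) * f (2 * r ^ 2 * (1 - cos x))) / r := by
  have hs : 0 < sin (x / 2) :=
    sin_pos_of_pos_of_lt_pi (by linarith [hx.1]) (by linarith [hx.2])
  have hcos : cos x = 2 * cos (x / 2) ^ 2 - 1 := by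
    rw [← cos_two_mul]; ring_nf
  have hsin : sin x = 2 * sin (x / 2) * cos (x / 2) := by
    rw [← sin_two_mul]; ring_nf
  have hsqrt : √(2 * r ^ 2 * (1 - cos x)) = 2 * r * sin (x / 2) := by
    rw [show 2 * r ^ 2 * (1 - cos x) = (2 * r * sin (x / 2)) ^ 2 by
      rw [hcos, mul_pow, sin_sq]; ring]
    exact sqrt_sq (by positivity)
  rw [hsqrt, hsin]
  field_simp

/-- If `f` is positive on `(0,∞)` and `x ↦ √x · f x` is decreasing on
`(0,∞)`, and `r > 0`, then `g(x) = sin x · f(2r²(1 − cos x))` is decreasing on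
`(0, 2π)`. -/
theorem g_antitone_on_Ioo
    (f : ℝ → ℝ) (hf_pos : ∀ x > 0, 0 < f x)
    (hf_dec : AntitoneOn (fun x => Real.sqrt x * f x) (Set.Ioi 0))
    (r : ℝ) (hr : 0 < r) :
    AntitoneOn (fun x => Real.sin x * f (2 * r ^ 2 * (1 - Real.cos x)))
      (Set.Ioo 0 (2 * π)) := by
  have arg_eq (x : ℝ) : 2 * r ^ 2 * (1 - cos x) = 4 * r ^ 2 * (1 - cos (x / 2) ^ 2) := by
    have : cos x = 2 * cos (x / 2) ^ 2 - 1 := by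
      rw [← cos_two_mul]; ring_nf
    rw [this]; ring
  have arg_pos {x : ℝ} (hx : x ∈ Set.Ioo 0 (2 * π)) : 0 < 2 * r ^ 2 * (1 - cos x) := by
    have hs : 0 < sin (x / 2) :=
      sin_pos_of_pos_of_lt_pi (by linarith [hx.1]) (by linarith [hx.2])
    rw [arg_eq, ← sin_sq]
    positivity
  have h_pos {u : ℝ} (hu : 0 < u) : 0 < √u * f u := mul_pos (sqrt_pos.2 hu) (hf_pos u hu)
  intro x hx y hy hxy
  have hcos : cos (y / 2) ≤ cos (x / 2) :=
    cos_le_cos_of_nonneg_of_le_pi (by linarith [hx.1]) (by linarith [hy.2]) (by linarith)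
  have hX := h_pos (arg_pos hx)
  have hY := h_pos (arg_pos hy)
  simp only [sin_mul_comp_eq_cos_half_mul f hr hx, sin_mul_comp_eq_cos_half_mul f hr hy]
  refine div_le_div_of_nonneg_right ?_ hr.le
  rcases le_total 0 (cos (y / 2)) with hd | hd
  · refine mul_le_mul hcos (hf_dec (arg_pos hx) (arg_pos hy) ?_) hY.le (hd.trans hcos)
    rw [arg_eq, arg_eq]
    gcongr
  · rcases le_total 0 (cos (x / 2)) with hc | hc
    · exact (mul_nonpos_of_nonpos_of_nonneg hd hY.le).trans (mul_nonneg hc hX.le)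
    · have hle := hf_dec (arg_pos hy) (arg_pos hx) (by
        rw [arg_eq, arg_eq]
        have : cos (x / 2) ^ 2 ≤ cos (y / 2) ^ 2 := by nlinarith
        gcongr)
      exact (mul_le_mul_of_nonneg_right hcos hY.le).trans (mul_le_mul_of_nonpos_left hle hc)
end

section
/- Let 0 < r < √10/5. Then the function y ↦ y⁻¹·(2r² − r⁴y)^{−3/2} is decreasing on the interval (0, 2]. Consequently, for the spherical curved-kernel f defined by f(y) := (2r²y − r⁴y²)^{−3/2}, the function y ↦ √y·f(y) is decreasing on (0, 2]. (Note that 2r² − r⁴y > 0 for y ∈ (0,2] since r < 1.) -/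
open Real

lemma sq_mul_five_sub_cube_le {x y : ℝ} (hx : 0 < x) (hxy : x ≤ y) :
    x ^ 2 * (5 * y - 2 * x) ^ 3 ≤ 27 * y ^ 5 := by
  have hy : 0 < y := hx.trans_le hxy
  have hq : 0 ≤ 8 * x ^ 3 + 27 * y ^ 3 + x * y * (44 * (y - x) + 10 * y) := by
    have := sub_nonneg.2 hxy
    positivity
  linear_combination mul_nonneg (sq_nonneg (y - x)) hq

lemma sq_mul_linear_cube_le {a b x y : ℝ} (hx : 0 < x) (hxy : x ≤ y)
    (hb : 0 ≤ b) (hy : 5 * b * y ≤ 2 * a) :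
    x ^ 2 * (a - b * x) ^ 3 ≤ y ^ 2 * (a - b * y) ^ 3 := by
  have hy0 : 0 < y := hx.trans_le hxy
  have hby : 0 ≤ b * y := by positivity
  have hbxy : b * x ≤ b * y := by gcongr
  have hv : 0 ≤ a - b * y := by linarith
  have hu : 0 ≤ a - b * x := by linarith
  have h : 3 * y * (a - b * x) ≤ (a - b * y) * (5 * y - 2 * x) := by
    linear_combination mul_nonneg (sub_nonneg.2 hxy) (sub_nonneg.2 hy)
  have hcube := pow_le_pow_left₀ (by positivity) h 3
  have h₁ := mul_le_mul_of_nonneg_left hcube (sq_nonneg x)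
  have h₂ := mul_le_mul_of_nonneg_left (sq_mul_five_sub_cube_le hx hxy) (pow_nonneg hv 3)
  refine le_of_mul_le_mul_left ?_ (by positivity : (0 : ℝ) < 27 * y ^ 3)
  linear_combination h₁ + h₂

lemma inv_mul_rpow_eq_rpow_neg_half {y v : ℝ} (hy : 0 < y) (hv : 0 < v) :
    y⁻¹ * v ^ (-(3 / 2 : ℝ)) = (y ^ 2 * v ^ 3) ^ (-(1 / 2 : ℝ)) := by
  rw [mul_rpow (by positivity) (by positivity), ← rpow_natCast y, ← rpow_natCast v,
    ← rpow_mul hy.le, ← rpow_mul hv.le, ← rpow_neg_one]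
  norm_num

lemma sqrt_mul_mul_rpow_neg {y v : ℝ} (hy : 0 < y) (hv : 0 ≤ v) :
    √y * (y * v) ^ (-(3 / 2 : ℝ)) = y⁻¹ * v ^ (-(3 / 2 : ℝ)) := by
  rw [mul_rpow hy.le hv, ← mul_assoc, sqrt_eq_rpow, ← rpow_add hy, ← rpow_neg_one]
  norm_num

/-- For `0 < r < √10/5`, the function `y ↦ y⁻¹ (2r² − r⁴y)^{-3/2}` is
decreasing on `(0, 2]`; consequently, for the spherical curved kernel
`f(y) = (2r²y − r⁴y²)^{-3/2}`, the function `y ↦ √y · f(y)` is decreasing on `(0, 2]`. -/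
theorem spherical_kernel_antitone
    (r : ℝ) (hr0 : 0 < r) (hr : r < Real.sqrt 10 / 5) :
    AntitoneOn (fun y => y⁻¹ * (2 * r ^ 2 - r ^ 4 * y) ^ (-(3 / 2 : ℝ)))
      (Set.Ioc 0 2) ∧
    AntitoneOn
      (fun y => Real.sqrt y * (2 * r ^ 2 * y - r ^ 4 * y ^ 2) ^ (-(3 / 2 : ℝ)))
      (Set.Ioc 0 2) := by
  have hr2 : r ^ 2 < 2 / 5 := by
    have h := pow_lt_pow_left₀ hr hr0.le two_ne_zero
    rw [div_pow, sq_sqrt (by norm_num)] at h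
    linarith
  have hlin : ∀ y ∈ Set.Ioc (0 : ℝ) 2, 5 * r ^ 4 * y ≤ 2 * (2 * r ^ 2) := by
    intro y hy
    have h₁ : r ^ 4 * y ≤ r ^ 4 * 2 := by gcongr; exact hy.2
    have h₂ : r ^ 2 * r ^ 2 ≤ r ^ 2 * (2 / 5) := by gcongr
    linear_combination 5 * h₁ + 10 * h₂
  have hpos : ∀ y ∈ Set.Ioc (0 : ℝ) 2, 0 < 2 * r ^ 2 - r ^ 4 * y := by
    intro y hy
    have := hlin y hy
    have : 0 < r ^ 2 := by positivity
    linarith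
  have hanti : AntitoneOn (fun y => y⁻¹ * (2 * r ^ 2 - r ^ 4 * y) ^ (-(3 / 2 : ℝ)))
      (Set.Ioc 0 2) := by
    intro x hx y hy hxy
    have hu := hpos x hx
    have hx0 := hx.1
    simp only
    rw [inv_mul_rpow_eq_rpow_neg_half hx0 hu, inv_mul_rpow_eq_rpow_neg_half hy.1 (hpos y hy)]
    exact rpow_le_rpow_of_nonpos (by positivity)
      (sq_mul_linear_cube_le hx0 hxy (by positivity) (hlin y hy)) (by norm_num)
  refine ⟨hanti, hanti.congr fun y hy => ?_⟩
  simp only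
  rw [← sqrt_mul_mul_rpow_neg hy.1 (hpos y hy).le]
  ring_nf
end

section
/- Let n ≥ 2, let σ = ±1, and let q_1,…,q_n be a circular solution of the curved n-body system on M_σ². Then q_i(t) ⊙ q_j(t) = −r(t)²·(1 − cos(θ_j(t) − θ_i(t))) + σ for all i ≠ j, and for every i ∈ {1,…,n} and every t the tangential equation holds: 2r'(t)·θ_i'(t) + r(t)·θ_i''(t) = r(t)·Σ_{j≠i} m_j·sin(θ_j(t) − θ_i(t))·( 2r(t)²(1 − cos(θ_j(t) − θ_i(t))) − σ·( r(t)²(1 − cos(θ_j(t) − θ_i(t))) )² )^{−3/2}. -/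
open Real

/-- The derivative of a differentiable curve in `ℝ × ℝ × ℝ` is computed coordinatewise. -/
theorem deriv_prodMk_prodMk {x y z : ℝ → ℝ} (hx : Differentiable ℝ x) (hy : Differentiable ℝ y)
    (hz : Differentiable ℝ z) :
    deriv (fun t => (x t, y t, z t)) = fun t => (deriv x t, deriv y t, deriv z t) :=
  funext fun t =>
    ((hx t).hasDerivAt.prodMk ((hy t).hasDerivAt.prodMk (hz t).hasDerivAt)).deriv

/-- The tangential component of the acceleration of a curve given in cylindrical coordinates. -/
theorem tangential_acceleration_cylindrical {r θ z : ℝ → ℝ} (hr : ContDiff ℝ 2 r)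
    (hθ : ContDiff ℝ 2 θ) (hz : ContDiff ℝ 2 z) (t : ℝ) :
    let a := deriv (deriv fun s => (r s * cos (θ s), r s * sin (θ s), z s)) t
    cos (θ t) * a.2.1 - sin (θ t) * a.1 = 2 * deriv r t * deriv θ t + r t * deriv (deriv θ) t := by
  have hr₁ : Differentiable ℝ r := hr.differentiable (by norm_num)
  have hθ₁ : Differentiable ℝ θ := hθ.differentiable (by norm_num)
  have hz₁ : Differentiable ℝ z := hz.differentiable (by norm_num)
  have hr₂ : Differentiable ℝ (deriv r) := hr.differentiable_deriv_two
  have hθ₂ : Differentiable ℝ (deriv θ) := hθ.differentiable_deriv_two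
  have hz₂ : Differentiable ℝ (deriv z) := hz.differentiable_deriv_two
  have hx : deriv (fun s => r s * cos (θ s)) =
      fun s => deriv r s * cos (θ s) + r s * (-sin (θ s) * deriv θ s) :=
    funext fun s => ((hr₁ s).hasDerivAt.mul (hθ₁ s).hasDerivAt.cos).deriv
  have hy : deriv (fun s => r s * sin (θ s)) =
      fun s => deriv r s * sin (θ s) + r s * (cos (θ s) * deriv θ s) :=
    funext fun s => ((hr₁ s).hasDerivAt.mul (hθ₁ s).hasDerivAt.sin).deriv
  have hxx := (((hr₂ t).hasDerivAt.mul (hθ₁ t).hasDerivAt.cos).add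
    ((hr₁ t).hasDerivAt.mul ((hθ₁ t).hasDerivAt.sin.neg.mul (hθ₂ t).hasDerivAt))).deriv
  have hyy := (((hr₂ t).hasDerivAt.mul (hθ₁ t).hasDerivAt.sin).add
    ((hr₁ t).hasDerivAt.mul ((hθ₁ t).hasDerivAt.cos.mul (hθ₂ t).hasDerivAt))).deriv
  intro a
  have ha : a = deriv (deriv fun s => (r s * cos (θ s), r s * sin (θ s), z s)) t := rfl
  rw [deriv_prodMk_prodMk (by fun_prop) (by fun_prop) hz₁, hx, hy,
    deriv_prodMk_prodMk (by fun_prop) (by fun_prop) hz₂] at ha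
  have ha₁ := (congrArg Prod.fst ha).trans hxx
  have ha₂ := (congrArg (fun v => v.2.1) ha).trans hyy
  rw [ha₁, ha₂]
  simp only [Pi.neg_apply, Pi.mul_apply]
  linear_combination (2 * deriv r t * deriv θ t + r t * deriv (deriv θ) t) *
    sin_sq_add_cos_sq (θ t)

/-- The form `⊙` between two points of the circle of radius `r` at height `z` in `M_σ²`. -/
theorem odot_circle {σ r z : ℝ} (h : r ^ 2 + σ * z ^ 2 = σ) (α β : ℝ) :
    odot σ (r * cos α, r * sin α, z) (r * cos β, r * sin β, z) =
      -(r ^ 2) * (1 - cos (β - α)) + σ := by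
  rw [cos_sub, odot]
  linear_combination h

/-- For a circular solution of the curved `n`-body problem on `M_σ²`,
one has `q_i ⊙ q_j = −r²(1 − cos(θ_j − θ_i)) + σ` for `i ≠ j`, and the tangential
equation holds for every body and every time.
Bodies are indexed by `i ∈ {0, …, n-1}`. -/
theorem curved_circular_odot_and_tangential
    (n : ℕ) (hn : 2 ≤ n)
    (σ : ℝ) (hσ : σ = 1 ∨ σ = -1)
    -- the (constant) masses, positive
    (m : ℕ → ℝ) (hm : ∀ i < n, 0 < m i)
    -- the radius, twice continuously differentiable and positive
    (r : ℝ → ℝ) (hr : ContDiff ℝ 2 r) (hr_pos : ∀ t, 0 < r t)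
    -- the third coordinate, twice continuously differentiable, with `r² + σz² = σ`
    (z : ℝ → ℝ) (hz : ContDiff ℝ 2 z) (hsphere : ∀ t, r t ^ 2 + σ * z t ^ 2 = σ)
    -- the angles, twice continuously differentiable and ordered
    (θ : ℕ → ℝ → ℝ) (hθ : ∀ i < n, ContDiff ℝ 2 (θ i))
    (hord : ∀ t, ∀ i j, i < j → j < n → θ i t < θ j t)
    (hord2 : ∀ t, ∀ i < n, θ i t < θ 0 t + 2 * π)
    -- the bodies, lying on a circle of radius `r` at height `z` in `M_σ²`
    (q : ℕ → ℝ → ℝ × ℝ × ℝ)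
    (hq : ∀ i < n, ∀ t,
      q i t = (r t * Real.cos (θ i t), r t * Real.sin (θ i t), z t))
    -- the curved equations of motion
    (hODE : ∀ i < n, ∀ t, deriv (deriv (q i)) t =
      (∑ j ∈ (Finset.range n).erase i,
        (m j * (σ - σ * (odot σ (q i t) (q j t)) ^ 2) ^ (-(3 / 2 : ℝ))) •
          (q j t - (σ * odot σ (q i t) (q j t)) • q i t))
      - (σ * odot σ (deriv (q i) t) (deriv (q i) t)) • q i t) :
    -- conclusion: the `⊙` identity and the tangential equation
    (∀ i < n, ∀ j < n, i ≠ j → ∀ t,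
      odot σ (q i t) (q j t) = -(r t ^ 2) * (1 - Real.cos (θ j t - θ i t)) + σ) ∧
    (∀ i < n, ∀ t,
      2 * deriv r t * deriv (θ i) t + r t * deriv (deriv (θ i)) t =
        r t * ∑ j ∈ (Finset.range n).erase i,
          m j * Real.sin (θ j t - θ i t) *
            (2 * r t ^ 2 * (1 - Real.cos (θ j t - θ i t)) -
              σ * (r t ^ 2 * (1 - Real.cos (θ j t - θ i t))) ^ 2) ^ (-(3 / 2 : ℝ))) := by
  have hodot : ∀ i < n, ∀ j < n, ∀ t,
      odot σ (q i t) (q j t) = -(r t ^ 2) * (1 - Real.cos (θ j t - θ i t)) + σ := by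
    intro i hi j hj t
    rw [hq i hi, hq j hj, odot_circle (hsphere t)]
  refine ⟨fun i hi j hj _ t => hodot i hi j hj t, fun i hi t => ?_⟩
  have hσ2 : σ ^ 2 = 1 := by rcases hσ with rfl | rfl <;> norm_num
  have hacc := tangential_acceleration_cylindrical hr (hθ i hi) hz t
  rw [← funext (hq i hi), hODE i hi t] at hacc
  rw [← hacc]
  simp only [Prod.fst_sub, Prod.snd_sub, Prod.fst_sum, Prod.snd_sum, Prod.smul_fst, Prod.smul_snd,
    smul_eq_mul, hq i hi t]
  have hcomb (A B k : ℝ) : cos (θ i t) * (A - k * (r t * sin (θ i t))) -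
      sin (θ i t) * (B - k * (r t * cos (θ i t))) = cos (θ i t) * A - sin (θ i t) * B := by ring
  rw [hcomb, Finset.mul_sum, Finset.mul_sum, Finset.mul_sum, ← Finset.sum_sub_distrib]
  refine Finset.sum_congr rfl fun j hj => ?_
  have hjn : j < n := Finset.mem_range.1 (Finset.mem_of_mem_erase hj)
  have hbase : σ - σ * (-(r t ^ 2) * (1 - cos (θ j t - θ i t)) + σ) ^ 2 =
      2 * r t ^ 2 * (1 - cos (θ j t - θ i t)) -
        σ * (r t ^ 2 * (1 - cos (θ j t - θ i t))) ^ 2 := by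
    linear_combination (2 * r t ^ 2 * (1 - cos (θ j t - θ i t)) - σ) * hσ2
  rw [← hq i hi t, hodot i hi j hjn t, hbase, hq j hjn t, sin_sub]
  ring
end
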